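/- Let {σ₁, σ₂} be a dyad of involutions of g, i.e., σ₁ and σ₂ are distinct commuting involutions conjugate by an inner automorphism of g. Then there exists an inner automorphism φ of g with φ⁴ = id such that σ₂ = φ∘σ₁∘φ⁻¹ and σ₁∘σ₂ = φ². -/

import Mathlib

open LieAlgebra Module

variable (k : Type*) [Field k] [IsAlgClosed k] [CharZero k]
variable (g : Type*) [LieRing g] [LieAlgebra k g] [FiniteDimensional k g]
  [LieAlgebra.IsSemisimple k g]

/-- The eigenspace of a Lie algebra automorphism `σ` for the eigenvalue `c`. -/
noncomputable def eigSub (σ : g ≃ₗ⁅k⁆ g) (c : k) : Submodule k g :=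
  Module.End.eigenspace (σ.toLinearEquiv : g →ₗ[k] g) c

/-- A Lie algebra involution: an automorphism `σ` with `σ ∘ σ = id`. -/
def IsInvolution (σ : g ≃ₗ⁅k⁆ g) : Prop := ∀ x, σ (σ x) = x

/-- Two commuting involutions. -/
def CommutingInvolutions (σ₁ σ₂ : g ≃ₗ⁅k⁆ g) : Prop :=
  IsInvolution k g σ₁ ∧ IsInvolution k g σ₂ ∧ ∀ x, σ₁ (σ₂ x) = σ₂ (σ₁ x)

/-- The subspace `g_{ij}` of the quaternionic decomposition determined by commuting
involutions `σ₁, σ₂`: here `i, j : Bool` and `false, true` encode the exponents `0, 1`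
of the eigenvalues `(-1)^i`, `(-1)^j`. -/
noncomputable def qSpace (σ₁ σ₂ : g ≃ₗ⁅k⁆ g) (i j : Bool) : Submodule k g :=
  eigSub k g σ₁ (if i then -1 else 1) ⊓ eigSub k g σ₂ (if j then -1 else 1)

/-- `x` is a semisimple element of `g`: `ad x` is a semisimple endomorphism. -/
def IsSSElt (x : g) : Prop := Module.End.IsSemisimple (ad k g x)

/-- `x` is a nilpotent element of `g`: `ad x` is a nilpotent endomorphism. -/
def IsNilpElt (x : g) : Prop := IsNilpotent (ad k g x)

/-- `x` is a regular element of `g`: the dimension of its centralizer equals the rank of `g`,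
i.e. the dimension of a Cartan subalgebra of `g`. -/
def IsRegElt (x : g) : Prop :=
  ∃ H : LieSubalgebra k g, H.IsCartanSubalgebra ∧
    Module.finrank k (LinearMap.ker (ad k g x)) = Module.finrank k H

/-- An involution is of maximal rank if its `(-1)`-eigenspace contains a Cartan
subalgebra of `g`. -/
def IsMaxRank (σ : g ≃ₗ⁅k⁆ g) : Prop :=
  ∃ H : LieSubalgebra k g, H.IsCartanSubalgebra ∧ H.toSubmodule ≤ eigSub k g σ (-1)

/-- The centralizer of an element `x`, as a Lie subalgebra of `g`. -/
def zg (x : g) : LieSubalgebra k g where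
  carrier := {y | ⁅x, y⁆ = 0}
  add_mem' := by
    intro a b ha hb
    simp only [Set.mem_setOf_eq] at *
    rw [lie_add, ha, hb, add_zero]
  zero_mem' := by simp
  smul_mem' := by
    intro t a ha
    simp only [Set.mem_setOf_eq] at *
    rw [lie_smul, ha, smul_zero]
  lie_mem' := by
    intro a b ha hb
    simp only [Set.mem_setOf_eq] at *
    rw [leibniz_lie, ha, hb, lie_zero, zero_lie, add_zero]

/-- The fixed-point subalgebra of a Lie algebra automorphism. -/
def fixSubalgebra (σ : g ≃ₗ⁅k⁆ g) : LieSubalgebra k g where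
  carrier := {x | σ x = x}
  add_mem' := by
    intro a b ha hb
    simp only [Set.mem_setOf_eq] at *
    rw [show σ (a + b) = σ a + σ b from σ.toLieHom.map_add a b, ha, hb]
  zero_mem' := by simp only [Set.mem_setOf_eq]; exact σ.toLieHom.map_zero
  smul_mem' := by
    intro t a ha
    simp only [Set.mem_setOf_eq] at *
    rw [show σ (t • a) = t • σ a from σ.toLieHom.map_smul t a, ha]
  lie_mem' := by
    intro a b ha hb
    simp only [Set.mem_setOf_eq] at *
    rw [LieEquiv.map_lie σ a b, ha, hb]

/-- The exponential of an endomorphism, as a finite sum (which is the genuine exponential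
when the endomorphism is nilpotent). -/
noncomputable def expEnd (f : Module.End k g) : Module.End k g :=
  ∑ i ∈ Finset.range (Module.finrank k g + 1), (i.factorial : k)⁻¹ • f ^ i

/-- An automorphism of `g` is inner if it lies in the subgroup of automorphisms generated
by the exponentials `exp (ad x)` with `ad x` nilpotent. -/
noncomputable def IsInnerAut (μ : g ≃ₗ⁅k⁆ g) : Prop :=
  μ.toLinearEquiv ∈ Subgroup.closure
    {e : g ≃ₗ[k] g | ∃ x : g, IsNilpotent (ad k g x) ∧
      (e : g →ₗ[k] g) = expEnd k g (ad k g x)}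

/-- `σ` and `τ` are conjugate by an inner automorphism of `g`. -/
noncomputable def InnerConj (σ τ : g ≃ₗ⁅k⁆ g) : Prop :=
  ∃ φ : g ≃ₗ⁅k⁆ g, IsInnerAut k g φ ∧ ∀ x, τ x = φ (σ (φ.symm x))

/-- A dyad: a pair of distinct commuting involutions that are conjugate by an inner
automorphism of `g`. -/
noncomputable def IsDyad (σ₁ σ₂ : g ≃ₗ⁅k⁆ g) : Prop :=
  IsInvolution k g σ₁ ∧ IsInvolution k g σ₂ ∧ σ₁ ≠ σ₂ ∧
    (∀ x, σ₁ (σ₂ x) = σ₂ (σ₁ x)) ∧ InnerConj k g σ₁ σ₂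

/-- The span of all brackets `⁅x, y⁆` with `x, y` in a subspace `m`. -/
noncomputable def bracketSpan (m : Submodule k g) : Submodule k g :=
  Submodule.span k {z | ∃ x ∈ m, ∃ y ∈ m, z = ⁅x, y⁆}

/-- `c` is a Cartan subspace of a subspace `m ⊆ g`: it consists of pairwise commuting
semisimple elements of `g` and is maximal among such subspaces of `m`. -/
def IsCartanSubspace (m c : Submodule k g) : Prop :=
  c ≤ m ∧ (∀ x ∈ c, IsSSElt k g x) ∧ (∀ x ∈ c, ∀ y ∈ c, ⁅x, y⁆ = 0) ∧
    ∀ c' : Submodule k g, c' ≤ m → (∀ x ∈ c', IsSSElt k g x) →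
      (∀ x ∈ c', ∀ y ∈ c', ⁅x, y⁆ = 0) → c ≤ c' → c' = c

section Helpers
set_option linter.unusedSectionVars false
variable {k g}

section Part1
lemma exists_funCalc (T : End k g) (F : k → k) :
    ∃ L : End k g, ∀ μ, ∀ v ∈ T.maxGenEigenspace μ, L v = F μ • v := by
  classical
  have hI := DirectSum.isInternal_submodule_of_iSupIndep_of_iSup_eq_top
    (End.independent_maxGenEigenspace T) (End.iSup_maxGenEigenspace_eq_top T)
  let e := LinearEquiv.ofBijective (DirectSum.coeLinearMap T.maxGenEigenspace) hI
  refine ⟨(DirectSum.toModule k k g (fun μ => F μ • (T.maxGenEigenspace μ).subtype)) ∘ₗ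
    e.symm.toLinearMap, fun μ v hv => ?_⟩
  have : e.symm v = DirectSum.lof k k (fun μ => T.maxGenEigenspace μ) μ ⟨v, hv⟩ := by
    rw [LinearEquiv.symm_apply_eq]
    exact (DirectSum.coeLinearMap_lof T.maxGenEigenspace μ ⟨v, hv⟩).symm
  simp [this]

@[elab_as_elim]
lemma maxGen_induction (T : End k g) {p : g → Prop} (h0 : ∀ μ, ∀ v ∈ T.maxGenEigenspace μ, p v)
    (hz : p 0) (hadd : ∀ x y, p x → p y → p (x + y)) (v : g) : p v := by
  have hv : v ∈ ⨆ μ, T.maxGenEigenspace μ := by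
    rw [End.iSup_maxGenEigenspace_eq_top]; trivial
  exact Submodule.iSup_induction _ (motive := p) hv h0 hz hadd

/-- generalized eigenspace of `ad x` -/
abbrev Wg (x : g) (μ : k) : Submodule k g := (ad k g x).maxGenEigenspace μ

lemma lie_mem_Wg {x : g} {μ ν : k} {v w : g} (hv : v ∈ Wg x μ) (hw : w ∈ Wg x ν) :
    ⁅v, w⁆ ∈ Wg x (μ + ν) :=
  LieModule.lie_mem_maxGenEigenspace_toEnd hv hw

variable (k) in
@[elab_as_elim]
lemma Wg_induction (x : g) {p : g → Prop} (h0 : ∀ μ : k, ∀ v ∈ Wg x μ, p v)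
    (hadd : ∀ x y, p x → p y → p (x + y)) (v : g) : p v :=
  maxGen_induction (ad k g x) h0 (h0 0 0 (Submodule.zero_mem _)) hadd v

lemma mem_Wg_of_lie {x v : g} {μ : k} (h : ⁅x, v⁆ = μ • v) : v ∈ Wg x μ := by
  rw [End.mem_maxGenEigenspace]
  exact ⟨1, by simp [h]⟩

lemma ad_inj (k : Type*) [Field k] [IsAlgClosed k] [CharZero k] {g : Type*} [LieRing g]
    [LieAlgebra k g] [FiniteDimensional k g] [LieAlgebra.IsSemisimple k g] {s t : g} (h : ∀ v : g, ⁅s, v⁆ = ⁅t, v⁆) : s = t := by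
  have : s - t ∈ LieAlgebra.center k g := by
    rw [LieModule.mem_maxTrivSubmodule]
    intro v
    rw [← lie_skew, sub_lie, h, sub_self, neg_zero]
  rw [LieAlgebra.center_eq_bot, LieSubmodule.mem_bot] at this
  exact sub_eq_zero.1 this

lemma exists_ssElt (x : g) (f : k →+ k) :
    ∃ s : g, ∀ μ, ∀ v ∈ Wg x μ, ⁅s, v⁆ = f μ • v := by
  obtain ⟨L, hL⟩ := exists_funCalc (ad k g x) f
  have hd : ∀ a b, L ⁅a, b⁆ = ⁅a, L b⁆ - ⁅b, L a⁆ := by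
    intro a b
    refine Wg_induction k x (fun μ v hv => ?_) (fun v w hv hw => ?_) a
    · refine Wg_induction k x (fun ν w hw => ?_) (fun v w hv hw => ?_) b
      · rw [hL _ _ (lie_mem_Wg hv hw), hL _ _ hv, hL _ _ hw, lie_smul, lie_smul, ← lie_skew w v,
          map_add, add_smul]
        simp only [smul_neg]; abel
      · simp only [lie_add, map_add, add_lie, hv, hw]; abel
    · simp only [lie_add, map_add, add_lie, hv, hw]; abel
  obtain ⟨s, hs⟩ := LieDerivation.IsKilling.exists_eq_ad (R := k)
    ({ L with leibniz' := hd } : LieDerivation k g g)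
  refine ⟨s, fun μ v hv => ?_⟩
  have := congrArg (fun D : LieDerivation k g g => D v) hs
  simp only [LieDerivation.ad_apply_apply] at this
  rw [this]
  exact hL μ v hv

lemma map_mem_Wg (τ : g ≃ₗ⁅k⁆ g) {x v : g} {μ : k} (hv : v ∈ Wg x μ) : τ v ∈ Wg (τ x) μ := by
  rw [End.mem_maxGenEigenspace] at hv ⊢
  obtain ⟨n, hn⟩ := hv
  refine ⟨n, ?_⟩
  have : ∀ (n : ℕ) (w : g), ((ad k g (τ x) - μ • (1 : End k g)) ^ n) (τ w) = τ (((ad k g x - μ • (1 : End k g)) ^ n) w) := by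
    intro n
    induction n with
    | zero => simp
    | succ n ih =>
      intro w
      rw [pow_succ, pow_succ, End.mul_apply, End.mul_apply, ← ih]
      simp [LieEquiv.map_lie]
  rw [this, hn, map_zero]

lemma neg_mem_Wg {x v : g} {μ : k} (hv : v ∈ Wg x μ) : v ∈ Wg (-x) (-μ) := by
  rw [End.mem_maxGenEigenspace] at hv ⊢
  obtain ⟨n, hn⟩ := hv
  refine ⟨n, ?_⟩
  have : (ad k g (-x) - (-μ) • 1) = - (ad k g x - μ • 1) := by
    rw [map_neg, neg_smul]; abel
  rw [this, neg_pow, End.mul_apply, hn, map_zero]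

lemma ssElt_comm {x s y : g} {f : k →+ k} (hs : ∀ μ, ∀ v ∈ Wg x μ, ⁅s, v⁆ = f μ • v)
    (hy : ⁅x, y⁆ = 0) : ⁅s, y⁆ = 0 := by
  have := hs 0 y (mem_Wg_of_lie (by simp [hy]))
  simpa using this

lemma ssElt_fix {x s : g} {f : k →+ k} (hs : ∀ μ, ∀ v ∈ Wg x μ, ⁅s, v⁆ = f μ • v)
    (τ : g ≃ₗ⁅k⁆ g) {ε : k} (hε : ε = 1 ∨ ε = -1) (hx : τ x = ε • x) : τ s = ε • s := by
  apply ad_inj k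
  intro v
  refine Wg_induction k x (fun μ v hv => ?_) (fun v w hv hw => ?_) v
  · have key : ∀ ν : k, τ.symm v ∈ Wg x ν → ⁅τ s, v⁆ = f ν • v := by
      intro ν h
      have := congrArg τ (hs ν _ h)
      simpa [LieEquiv.map_lie] using this
    rcases hε with rfl | rfl
    · rw [key μ, one_smul, hs μ v hv]
      have h1 := map_mem_Wg τ.symm hv
      have : τ.symm x = x := by rw [LieEquiv.symm_apply_eq, hx, one_smul]
      rwa [this] at h1
    · rw [key (-μ), smul_lie, hs μ v hv, map_neg, neg_smul, neg_smul, one_smul]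
      have h1 := map_mem_Wg τ.symm (neg_mem_Wg hv)
      have : τ.symm (-x) = x := by rw [LieEquiv.symm_apply_eq, hx, neg_smul, one_smul]
      rwa [this] at h1
  · simp only [lie_add, hv, hw]

lemma ssElt_ker {x s y : g} {f : k →+ k} (hs : ∀ μ, ∀ v ∈ Wg x μ, ⁅s, v⁆ = f μ • v)
    (hy : ⁅s, ⁅s, y⁆⁆ = 0) : ⁅s, y⁆ = 0 := by
  obtain ⟨L, hL⟩ := exists_funCalc (ad k g x) (fun μ => (f μ)⁻¹)
  have : ∀ v, L ⁅s, ⁅s, v⁆⁆ = ⁅s, v⁆ := by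
    intro v
    refine Wg_induction k x (fun μ v hv => ?_) (fun v w hv hw => ?_) v
    · rw [hs μ v hv, lie_smul, hs μ v hv, map_smul, map_smul, hL μ v hv, smul_smul]
      by_cases h : f μ = 0
      · simp [h]
      · rw [smul_smul, mul_inv_cancel_right₀ h]
    · simp only [lie_add, map_add, hv, hw]
  rw [← this, hy, map_zero]
end Part1

section Part2
/-- exponential-like functions -/
def IsExpF {k : Type*} [Field k] (E : k → k) : Prop := E 0 = 1 ∧ ∀ a b, E (a + b) = E a * E b

lemma exists_exp {s : k} (hs : s ≠ 0) (u : kˣ) : ∃ E : k → k, IsExpF E ∧ E s = u := by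
  have hsurj : ∀ {n : ℤ}, n ≠ 0 → Function.Surjective (fun a : Additive kˣ => n • a) := by
    have key : ∀ n : ℕ, n ≠ 0 → ∀ b : kˣ, ∃ a : kˣ, a ^ n = b := by
      intro n hn b
      obtain ⟨z, hz⟩ := IsAlgClosed.exists_pow_nat_eq (b : k) (Nat.pos_of_ne_zero hn)
      have hz0 : z ≠ 0 := by
        rintro rfl
        rw [zero_pow hn] at hz
        exact b.ne_zero hz.symm
      exact ⟨Units.mk0 z hz0, Units.ext (by simpa using hz)⟩
    intro n hn b
    obtain ⟨a, ha⟩ := key n.natAbs (by simpa using hn) b.toMul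
    rcases Int.natAbs_eq n with h | h
    · refine ⟨Additive.ofMul a, ?_⟩
      rw [h]
      change Additive.ofMul (a ^ ((n.natAbs : ℕ) : ℤ)) = b
      rw [zpow_natCast, ha]; rfl
    · refine ⟨Additive.ofMul a⁻¹, ?_⟩
      rw [h]
      change Additive.ofMul (a⁻¹ ^ (-((n.natAbs : ℕ) : ℤ))) = b
      rw [inv_zpow', neg_neg, zpow_natCast, ha]; rfl
  let _ : DivisibleBy (Additive kˣ) ℤ := divisibleByOfSMulRightSurj (Additive kˣ) ℤ hsurj
  have hB := Module.Baer.of_divisible (Additive kˣ)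
  let f1 : ℤ →+ k := (zmultiplesHom k) s
  have hf1 : Function.Injective f1 := by
    rw [injective_iff_map_eq_zero]
    intro a ha
    simp only [f1, zmultiplesHom_apply, zsmul_eq_mul, mul_eq_zero, hs, or_false] at ha
    exact_mod_cast ha
  obtain ⟨h, hh⟩ := hB.extension_property_addMonoidHom f1 hf1
    ((zmultiplesHom (Additive kˣ)) (Additive.ofMul u))
  refine ⟨fun a => ((h a).toMul : kˣ), ⟨by simp, fun a b => by simp⟩, ?_⟩
  have := DFunLike.congr_fun hh 1
  simp [f1] at this
  simp [this]

lemma exists_exp_sep (S : Finset k) (hS : ∀ s ∈ S, s ≠ 0) :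
    ∃ E : k → k, IsExpF E ∧ ∀ s ∈ S, E s ≠ 1 := by
  obtain ⟨f, hf⟩ := Module.exists_dual_forall_apply_ne_zero (K := ℚ) (fun s : S => (s : k))
    (fun s => hS s s.2)
  obtain ⟨E, hE, hE1⟩ := exists_exp (one_ne_zero : (1 : k) ≠ 0) (Units.mk0 2 two_ne_zero)
  refine ⟨fun x => E ((f x : ℚ) : k), ⟨by simp [hE.1], fun a b => by simp [hE.2]⟩, ?_⟩
  intro s hs h
  set q : ℚ := f s with hq
  have hq0 : q ≠ 0 := hf ⟨s, hs⟩
  have hpow : ∀ (n : ℕ) (a : k), E (n * a) = E a ^ n := by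
    intro n a
    induction n with
    | zero => simp [hE.1]
    | succ n ih => rw [Nat.cast_succ, add_mul, one_mul, hE.2, ih, pow_succ]
  have h1 : E ((q.den : k) * (q : k)) = 1 := by
    rw [hpow]; simp only at h; rw [h, one_pow]
  have h2 : ((q.den : k) * (q : k)) = (q.num : k) := by
    rw [mul_comm]; exact_mod_cast Rat.mul_den_eq_num q
  rw [h2] at h1
  have hn0 : q.num ≠ 0 := by simpa using hq0
  have h3 : E ((q.num.natAbs : ℕ) : k) = 1 := by
    rcases Int.natAbs_eq q.num with h | h
    · rw [h] at h1; simpa using h1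
    · have h4 := hE.2 ((q.num : ℤ) : k) ((q.num.natAbs : ℕ) : k)
      rw [h1, one_mul] at h4
      rw [← h4]
      nth_rewrite 1 [h]
      simp [hE.1]
  have h5 := hpow q.num.natAbs 1
  rw [mul_one, h3, hE1] at h5
  have h6 : (1 : k) = ((2 ^ q.num.natAbs : ℕ) : k) := by simpa using h5
  have h7 : 1 = 2 ^ q.num.natAbs := by exact_mod_cast h6
  have : 1 < 2 ^ q.num.natAbs := Nat.one_lt_two_pow (by simpa using hn0)
  omega

lemma exists_D (x : g) {E : k → k} (hE : IsExpF E) :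
    ∃ D : g ≃ₗ⁅k⁆ g, ∀ μ, ∀ v ∈ Wg x μ, D v = E μ • v := by
  obtain ⟨L, hL⟩ := exists_funCalc (ad k g x) E
  obtain ⟨L', hL'⟩ := exists_funCalc (ad k g x) (fun μ => E (-μ))
  have hd : ∀ a b, L ⁅a, b⁆ = ⁅L a, L b⁆ := by
    intro a b
    refine Wg_induction k x (fun μ v hv => ?_) (fun v w hv hw => ?_) a
    · refine Wg_induction k x (fun ν w hw => ?_) (fun v w hv hw => ?_) b
      · rw [hL _ _ (lie_mem_Wg hv hw), hL _ _ hv, hL _ _ hw, lie_smul, smul_lie, smul_smul, hE.2,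
          mul_comm]
      · simp only [lie_add, map_add, hv, hw]
    · simp only [map_add, add_lie, hv, hw]
  have h1 : ∀ μ, E (-μ) * E μ = 1 := fun μ => by rw [← hE.2, neg_add_cancel, hE.1]
  refine ⟨{ L with map_lie' := hd _ _, invFun := L', left_inv := ?_, right_inv := ?_ }, hL⟩
  · intro v
    change L' (L v) = v
    refine Wg_induction k x (fun μ v hv => ?_) (fun v w hv hw => ?_) v
    · rw [hL μ v hv, map_smul, hL' μ v hv, smul_smul, mul_comm, h1, one_smul]
    · simp only [map_add, hv, hw]
  · intro v
    change L (L' v) = v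
    refine Wg_induction k x (fun μ v hv => ?_) (fun v w hv hw => ?_) v
    · rw [hL' μ v hv, map_smul, hL μ v hv, smul_smul, h1, one_smul]
    · simp only [map_add, hv, hw]

lemma nilp_of_killing {x : g}
    (h : ∀ (f : k →+ k) (s : g), (∀ μ, ∀ v ∈ Wg x μ, ⁅s, v⁆ = f μ • v) → killingForm k g x s = 0) :
    IsNilpotent (ad k g x) := by
  classical
  have hI := DirectSum.isInternal_submodule_of_iSupIndep_of_iSup_eq_top
    (End.independent_maxGenEigenspace (ad k g x)) (End.iSup_maxGenEigenspace_eq_top (ad k g x))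
  have hfin : {μ | Wg x μ ≠ ⊥}.Finite :=
    WellFoundedGT.finite_ne_bot_of_iSupIndep (End.independent_maxGenEigenspace (ad k g x))
  have hμ : ∀ μ : k, Wg x μ ≠ ⊥ → μ = 0 := by
    have hx : ∀ μ, Set.MapsTo (ad k g x) (Wg x μ) (Wg x μ) := fun μ =>
      (ad k g x).mapsTo_maxGenEigenspace_of_comm rfl μ
    have htr : ∀ μ, LinearMap.trace k _ ((ad k g x).restrict (hx μ)) = μ * finrank k (Wg x μ) := by
      intro μ
      have h1 := (ad k g x).isNilpotent_restrict_maxGenEigenspace_sub_algebraMap μ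
      have h2 := (LinearMap.isNilpotent_trace_of_isNilpotent h1).eq_zero
      have h3 : (ad k g x).restrict (hx μ) = ((ad k g x) - algebraMap k (End k g) μ).restrict
          ((ad k g x).mapsTo_maxGenEigenspace_of_comm (Algebra.mul_sub_algebraMap_commutes (ad k g x) μ) μ) + μ • LinearMap.id := by
        ext v
        change ad k g x v = (ad k g x v - algebraMap k (End k g) μ v) + μ • (v : g)
        simp
      rw [h3, map_add, h2, map_smul, LinearMap.trace_id, zero_add, smul_eq_mul]
    intro μ hμ
    by_contra hne
    obtain ⟨f, hf⟩ := Module.exists_dual_forall_apply_ne_zero (K := ℚ) (fun _ : Unit => (μ : k))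
      (fun s => hne)
    let F : k →+ k := (algebraMap ℚ k).toAddMonoidHom.comp f.toAddMonoidHom
    have hF : ∀ a, F a = ((f a : ℚ) : k) := fun a => rfl
    obtain ⟨s, hs⟩ := exists_ssElt x F
    have h0 := h F s hs
    rw [killingForm_apply_apply] at h0
    have hxs : ∀ μ : k, Set.MapsTo (ad k g x ∘ₗ ad k g s) (Wg x μ) (Wg x μ) := by
      intro μ v hv
      have : (ad k g x ∘ₗ ad k g s) v = F μ • ad k g x v := by
        simp [hs μ v hv]
      rw [this]
      exact Submodule.smul_mem _ _ (hx μ hv)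
    have htr2 : ∀ μ : k, LinearMap.trace k _ ((ad k g x ∘ₗ ad k g s).restrict (hxs μ)) = F μ * (μ * finrank k (Wg x μ)) := by
      intro μ
      rw [← htr, ← smul_eq_mul, ← map_smul]
      congr 1
      ext ⟨v, hv⟩
      change ⁅x, ⁅s, v⁆⁆ = F μ • ⁅x, v⁆
      rw [hs μ v hv, lie_smul]
    rw [LinearMap.trace_eq_sum_trace_restrict' hI hfin hxs] at h0
    simp only [htr2] at h0
    have h1 := congrArg f h0
    rw [map_sum, map_zero] at h1
    have h2 : ∀ ν : k, f (F ν * (ν * finrank k (Wg x ν))) = f ν * f ν * finrank k (Wg x ν) := by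
      intro ν
      have : F ν * (ν * finrank k (Wg x ν)) = (f ν * finrank k (Wg x ν) : ℚ) • ν := by
        rw [Rat.smul_def, hF]; push_cast; ring
      rw [this, map_smul, smul_eq_mul]; ring
    simp only [h2] at h1
    rw [Finset.sum_eq_zero_iff_of_nonneg (fun ν _ => mul_nonneg (mul_self_nonneg _) (Nat.cast_nonneg _))] at h1
    have h3 := h1 μ (by simpa using hμ)
    have h4 : finrank k (Wg x μ) ≠ 0 := by
      rw [Ne, Submodule.finrank_eq_zero]; exact hμ
    have h5 := hf ()
    simp_all
  have h0 : Wg x (0 : k) = ⊤ := by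
    rw [← End.iSup_maxGenEigenspace_eq_top (ad k g x)]
    refine le_antisymm (le_iSup (ad k g x).maxGenEigenspace 0) (iSup_le fun μ => ?_)
    by_cases hb : Wg x μ = ⊥
    · change Wg x μ ≤ _
      rw [hb]; exact bot_le
    · rw [hμ μ hb]
  refine ⟨finrank k g, ?_⟩
  ext v
  have hv : v ∈ (ad k g x).maxGenEigenspace 0 := by
    change v ∈ Wg x (0 : k)
    rw [h0]; trivial
  rw [End.maxGenEigenspace_eq_genEigenspace_finrank, End.mem_genEigenspace_nat] at hv
  simpa using hv
end Part2

section Part3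
/-- centralizer of a set -/
def zSet (k : Type*) [Field k] {g : Type*} [LieRing g] [LieAlgebra k g] (S : Set g) :
    LieSubalgebra k g where
  carrier := {x | ∀ y ∈ S, ⁅y, x⁆ = 0}
  add_mem' := fun {a b} ha hb y hy => by rw [lie_add, ha y hy, hb y hy, add_zero]
  zero_mem' := fun y hy => lie_zero y
  smul_mem' := fun t a ha y hy => by rw [lie_smul, ha y hy, smul_zero]
  lie_mem' := fun {a b} ha hb y hy => by
    rw [leibniz_lie, ha y hy, hb y hy, lie_zero, zero_lie, add_zero]

lemma mem_zSet {S : Set g} {x : g} : x ∈ zSet k S ↔ ∀ y ∈ S, ⁅y, x⁆ = 0 := Iff.rfl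

lemma exists_cartan (S : Set g) (hS : ∀ a ∈ S, ∀ b ∈ S, ⁅a, b⁆ = 0)
    (hker : ∀ y ∈ S, ∀ x : g, ⁅y, ⁅y, x⁆⁆ = 0 → ⁅y, x⁆ = 0) :
    ∃ H : LieSubalgebra k g, H.IsCartanSubalgebra ∧ ∀ y ∈ S, y ∈ H := by
  obtain ⟨u, hu⟩ := LieAlgebra.exists_isCartanSubalgebra_engel k (zSet k S)
  set H' := LieSubalgebra.engel k u
  have hmem : ∀ x, x ∈ ((zSet k S).incl.comp H'.incl).range ↔ ∃ hx : x ∈ zSet k S, (⟨x, hx⟩ : zSet k S) ∈ H' := by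
    intro x
    rw [LieHom.mem_range]
    constructor
    · rintro ⟨⟨⟨y, hy⟩, hy'⟩, rfl⟩
      exact ⟨hy, hy'⟩
    · rintro ⟨hx, hx'⟩
      exact ⟨⟨⟨x, hx⟩, hx'⟩, rfl⟩
  have hSH : ∀ y ∈ S, y ∈ ((zSet k S).incl.comp H'.incl).range := by
    intro y hy
    have hyZ : y ∈ zSet k S := fun z hz => hS z hz y hy
    rw [hmem]
    refine ⟨hyZ, ?_⟩
    rw [← hu.self_normalizing, LieSubalgebra.mem_normalizer_iff]
    rintro ⟨z, hz⟩ hz'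
    have : ⁅(⟨y, hyZ⟩ : zSet k S), (⟨z, hz⟩ : zSet k S)⁆ = 0 := Subtype.ext (hz y hy)
    rw [this]; exact H'.zero_mem
  refine ⟨((zSet k S).incl.comp H'.incl).range, ⟨?_, ?_⟩, hSH⟩
  · have := hu.nilpotent
    exact LieHom.isNilpotent_range _
  · refine le_antisymm ?_ (LieSubalgebra.le_normalizer _)
    intro x hx
    rw [LieSubalgebra.mem_normalizer_iff'] at hx
    have hxZ : x ∈ zSet k S := by
      intro y hy
      apply hker y hy
      obtain ⟨h1, _⟩ := (hmem _).1 (hx y (hSH y hy))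
      exact h1 y hy
    rw [hmem]
    refine ⟨hxZ, ?_⟩
    rw [← hu.self_normalizing, LieSubalgebra.mem_normalizer_iff']
    rintro ⟨z, hz⟩ hz'
    obtain ⟨h1, h2⟩ := (hmem _).1 (hx z ((hmem z).2 ⟨hz, hz'⟩))
    exact h2

section Cartan
variable (H : LieSubalgebra k g) [H.IsCartanSubalgebra]

lemma H_comm {a b : g} (ha : a ∈ H) (hb : b ∈ H) : ⁅a, b⁆ = 0 := by
  have := LieModule.IsTrivial.trivial (⟨a, ha⟩ : H) (⟨b, hb⟩ : H)
  simpa using congrArg Subtype.val this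

lemma H_self {x : g} (h : ∀ a ∈ H, ⁅a, x⁆ = 0) : x ∈ H := by
  rw [← (inferInstance : H.IsCartanSubalgebra).self_normalizing, LieSubalgebra.mem_normalizer_iff']
  intro y hy
  rw [h y hy]; exact H.zero_mem

lemma H_ker {a x : g} (ha : a ∈ H) (h : ⁅a, ⁅a, x⁆⁆ = 0) : ⁅a, x⁆ = 0 := by
  have := IsKilling.isSemisimple_ad_of_mem_isCartanSubalgebra ha
  have h2 := this.isFinitelySemisimple.maxGenEigenspace_eq_eigenspace 0
  have hx : x ∈ (ad k g a).maxGenEigenspace 0 := by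
    rw [End.mem_maxGenEigenspace]
    exact ⟨2, by simp [pow_two, h]⟩
  rw [h2, End.mem_eigenspace_iff] at hx
  simpa using hx

@[elab_as_elim]
lemma H_induction {p : g → Prop} (h0 : ∀ β : LieModule.Weight k H g, ∀ v, 
    (∀ a : H, ⁅(a : g), v⁆ = β a • v) → p v)
    (hz : p 0) (hadd : ∀ x y, p x → p y → p (x + y)) (v : g) : p v := by
  have hv : v ∈ ⨆ β : LieModule.Weight k H g, (LieModule.genWeightSpace g β).toSubmodule := by
    have := LieModule.iSup_genWeightSpace_eq_top' k H g
    rw [← LieSubmodule.toSubmodule_inj, LieSubmodule.iSup_toSubmodule] at this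
    rw [this]; trivial
  refine Submodule.iSup_induction _ (motive := p) hv (fun β v hv => ?_) hz hadd
  exact h0 β v (fun a => IsKilling.lie_eq_smul_of_mem_rootSpace hv a)

end Cartan

/-- A subspace contained in a Cartan subalgebra. -/
def Toral (c : Submodule k g) : Prop :=
  ∃ H : LieSubalgebra k g, H.IsCartanSubalgebra ∧ c ≤ H.toSubmodule

lemma toral_iff (c : Submodule k g) : Toral c ↔ (∀ a ∈ c, ∀ b ∈ c, ⁅a, b⁆ = 0) ∧
    ∀ y ∈ c, ∀ x : g, ⁅y, ⁅y, x⁆⁆ = 0 → ⁅y, x⁆ = 0 := by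
  constructor
  · rintro ⟨H, hH, hc⟩
    exact ⟨fun a ha b hb => H_comm H (hc ha) (hc hb), fun y hy x hx => H_ker H (hc hy) hx⟩
  · rintro ⟨h1, h2⟩
    obtain ⟨H, hH, hS⟩ := exists_cartan (k := k) (c : Set g) h1 h2
    exact ⟨H, hH, hS⟩
end Part3

section Part4
lemma toral_bot : Toral (⊥ : Submodule k g) := by
  rw [toral_iff]
  constructor
  · intro a ha b hb; rw [(Submodule.mem_bot k).1 ha, zero_lie]
  · intro y hy x _; rw [(Submodule.mem_bot k).1 hy, zero_lie]

lemma killing_nil_zero {x : g} (hx : IsNilpotent (ad k g x)) : killingForm k g x x = 0 := by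
  rw [killingForm_apply_apply]
  apply IsNilpotent.eq_zero
  apply LinearMap.isNilpotent_trace_of_isNilpotent
  have := hx.pow_succ 1
  rwa [pow_two] at this

lemma killing_lie (x y z : g) : killingForm k g ⁅x, y⁆ z = killingForm k g x ⁅y, z⁆ :=
  LieModule.traceForm_apply_lie_apply k g g x y z

lemma killing_comm (x y : g) : killingForm k g x y = killingForm k g y x :=
  LieModule.traceForm_comm k g g x y

lemma killing_eq_zero {x : g} (h : ∀ y, killingForm k g x y = 0) : x = 0 :=
  (IsKilling.killingForm_nondegenerate k g).1 x h

lemma maxToral (σ₁ σ₂ : g ≃ₗ⁅k⁆ g) (hi1 : ∀ x, σ₁ (σ₁ x) = x) (hi2 : ∀ x, σ₂ (σ₂ x) = x)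
    (hcomm : ∀ x, σ₁ (σ₂ x) = σ₂ (σ₁ x)) {ε₁ ε₂ : k} (he1 : ε₁ = 1 ∨ ε₁ = -1)
    (he2 : ε₂ = 1 ∨ ε₂ = -1) (c : Submodule k g)
    (hcV : ∀ x ∈ c, σ₁ x = ε₁ • x ∧ σ₂ x = ε₂ • x) (hc : Toral c)
    (hmax : ∀ c' : Submodule k g, Toral c' → (∀ x ∈ c', σ₁ x = ε₁ • x ∧ σ₂ x = ε₂ • x) →
      c ≤ c' → c' ≤ c) {x : g} (hxV : σ₁ x = ε₁ • x ∧ σ₂ x = ε₂ • x)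
    (hxc : ∀ a ∈ c, ⁅a, x⁆ = 0) : x ∈ c := by
  have hT := (toral_iff c).1 hc
  -- step 1
  have s1 : ∀ x : g, σ₁ x = ε₁ • x ∧ σ₂ x = ε₂ • x → (∀ a ∈ c, ⁅a, x⁆ = 0) →
      ∀ (f : k →+ k) (s : g), (∀ μ, ∀ v ∈ Wg x μ, ⁅s, v⁆ = f μ • v) → s ∈ c := by
    intro x hxV hxc f s hs
    have hsc : ∀ a ∈ c, ⁅s, a⁆ = 0 := fun a ha =>
      ssElt_comm hs (by rw [← lie_skew, hxc a ha, neg_zero])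
    obtain ⟨H, hH, hS⟩ := exists_cartan (k := k) ((c : Set g) ∪ {s}) (by
      rintro a (ha | ha) b (hb | hb)
      · exact hT.1 a ha b hb
      · rw [Set.mem_singleton_iff.1 hb, ← lie_skew, hsc a ha, neg_zero]
      · rw [Set.mem_singleton_iff.1 ha, hsc b hb]
      · rw [Set.mem_singleton_iff.1 ha, Set.mem_singleton_iff.1 hb, lie_self]) (by
      rintro y (hy | hy) z hz
      · exact hT.2 y hy z hz
      · rw [Set.mem_singleton_iff.1 hy] at hz ⊢
        exact ssElt_ker hs hz)
    have hle : c ⊔ Submodule.span k {s} ≤ H.toSubmodule := by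
      refine sup_le (fun y hy => hS y (Or.inl hy)) ?_
      rw [Submodule.span_le]
      rintro y hy
      exact hS y (Or.inr hy)
    refine hmax _ ⟨H, hH, hle⟩ ?_ le_sup_left
      (Submodule.mem_sup_right (Submodule.mem_span_singleton_self s))
    intro y hy
    obtain ⟨a, ha, b, hb, rfl⟩ := Submodule.mem_sup.1 hy
    obtain ⟨t, rfl⟩ := Submodule.mem_span_singleton.1 hb
    have h1 := ssElt_fix hs σ₁ he1 hxV.1
    have h2 := ssElt_fix hs σ₂ he2 hxV.2
    simp only [map_add, map_smul, h1, h2, (hcV a ha).1, (hcV a ha).2, smul_add]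
    exact ⟨by rw [smul_comm], by rw [smul_comm]⟩
  have s2 : ∀ x : g, σ₁ x = ε₁ • x ∧ σ₂ x = ε₂ • x → (∀ a ∈ c, ⁅a, x⁆ = 0) →
      (∀ a ∈ c, killingForm k g x a = 0) → IsNilpotent (ad k g x) := by
    intro x hxV hxc hk
    exact nilp_of_killing fun f s hs => hk s (s1 x hxV hxc f s hs)
  obtain ⟨H, hH, hcH⟩ := hc
  have hnd : ∀ y ∈ c, (∀ a ∈ c, killingForm k g y a = 0) → y = 0 := by
    intro y hy h
    exact IsKilling.eq_zero_of_isNilpotent_ad_of_mem_isCartanSubalgebra k g H (hcH hy)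
      (s2 y (hcV y hy) (fun a ha => hT.1 a ha y hy) h)
  -- step 3
  have s3 : ∀ x : g, σ₁ x = ε₁ • x ∧ σ₂ x = ε₂ • x → (∀ a ∈ c, ⁅a, x⁆ = 0) →
      (∀ a ∈ c, killingForm k g x a = 0) → ∀ y : g, σ₁ y = ε₁ • y ∧ σ₂ y = ε₂ • y →
      (∀ a ∈ c, ⁅a, y⁆ = 0) → (∀ a ∈ c, killingForm k g y a = 0) → killingForm k g x y = 0 := by
    intro x hx1 hx2 hx3 y hy1 hy2 hy3
    have h1 := killing_nil_zero (s2 x hx1 hx2 hx3)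
    have h2 := killing_nil_zero (s2 y hy1 hy2 hy3)
    have h3 := killing_nil_zero (s2 (x + y)
      ⟨by rw [map_add, hx1.1, hy1.1, smul_add], by rw [map_add, hx1.2, hy1.2, smul_add]⟩
      (fun a ha => by rw [lie_add, hx2 a ha, hy2 a ha, add_zero])
      (fun a ha => by rw [map_add, LinearMap.add_apply, hx3 a ha, hy3 a ha, add_zero]))
    simp only [map_add, LinearMap.add_apply, h1, h2, killing_comm y x] at h3
    have h4 : (2 : k) * killingForm k g x y = 0 := by linear_combination h3
    simpa using h4
  -- step 4
  have s4 : ∀ x : g, ∃ a ∈ c, ∀ b ∈ c, killingForm k g (x - a) b = 0 := by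
    intro x
    let T : c →ₗ[k] Dual k c := ((killingForm k g).domRestrict₁₂ c c)
    have hTinj : Function.Injective T := by
      rw [← LinearMap.ker_eq_bot, LinearMap.ker_eq_bot']
      intro a ha
      refine Subtype.ext (hnd a a.2 fun b hb => ?_)
      exact DFunLike.congr_fun ha ⟨b, hb⟩
    have hTs : Function.Surjective T :=
      (LinearMap.injective_iff_surjective_of_finrank_eq_finrank
        (Subspace.dual_finrank_eq (K := k) (V := c)).symm).1 hTinj
    obtain ⟨a, ha⟩ := hTs ((killingForm k g x).domRestrict c)
    refine ⟨a, a.2, fun b hb => ?_⟩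
    have := DFunLike.congr_fun ha ⟨b, hb⟩
    change killingForm k g a b = killingForm k g x b at this
    rw [map_sub, LinearMap.sub_apply, this, sub_self]
  have hee : ∀ ε : k, ε = 1 ∨ ε = -1 → ε * ε = 1 := by
    rintro ε (rfl | rfl) <;> ring
  -- reduce
  suffices key : ∀ x : g, σ₁ x = ε₁ • x ∧ σ₂ x = ε₂ • x → (∀ a ∈ c, ⁅a, x⁆ = 0) →
      (∀ a ∈ c, killingForm k g x a = 0) → x = 0 by
    obtain ⟨a, ha, hab⟩ := s4 x
    have := key (x - a)
      ⟨by rw [map_sub, hxV.1, (hcV a ha).1, smul_sub], by rw [map_sub, hxV.2, (hcV a ha).2, smul_sub]⟩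
      (fun b hb => by rw [lie_sub, hxc b hb, hT.1 b hb a ha, sub_zero]) hab
    rw [sub_eq_zero.1 this]; exact ha
  intro x hx1 hx2 hx3
  have s5 : ∀ z : g, σ₁ z = ε₁ • z ∧ σ₂ z = ε₂ • z → (∀ a ∈ c, ⁅a, z⁆ = 0) →
      killingForm k g x z = 0 := by
    intro z hz1 hz2
    obtain ⟨a, ha, hab⟩ := s4 z
    have := s3 x hx1 hx2 hx3 (z - a)
      ⟨by rw [map_sub, hz1.1, (hcV a ha).1, smul_sub], by rw [map_sub, hz1.2, (hcV a ha).2, smul_sub]⟩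
      (fun b hb => by rw [lie_sub, hz2 b hb, hT.1 b hb a ha, sub_zero]) hab
    rw [map_sub, hx3 a ha, sub_zero] at this
    exact this
  have proj : ∀ (σ : g ≃ₗ⁅k⁆ g) (ε : k), (∀ x, σ (σ x) = x) → (ε = 1 ∨ ε = -1) → σ x = ε • x →
      (∀ a ∈ c, σ a = ε • a) → ∀ z : g, (∀ a ∈ c, ⁅a, z⁆ = 0) → 
      σ (z + ε • σ z) = ε • (z + ε • σ z) ∧ (∀ a ∈ c, ⁅a, z + ε • σ z⁆ = 0) ∧
      killingForm k g x (z + ε • σ z) = 2 * killingForm k g x z := by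
    intro σ ε hσ hε hx ha z hz
    have hε2 := hee ε hε
    refine ⟨?_, ?_, ?_⟩
    · rw [map_add, map_smul, hσ, smul_add, smul_smul, hε2, one_smul, add_comm]
    · intro a hac
      have : ⁅a, σ z⁆ = 0 := by
        have h1 : ⁅σ a, z⁆ = 0 := by rw [ha a hac, smul_lie, hz a hac, smul_zero]
        have h2 := congrArg σ h1
        rwa [LieEquiv.map_lie, hσ, map_zero] at h2
      rw [lie_add, hz a hac, lie_smul, this, smul_zero, zero_add]
    · have h1 := killingForm_of_equiv_apply σ x (σ z)
      rw [hσ, hx, map_smul, LinearMap.smul_apply, smul_eq_mul] at h1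
      rw [map_add, map_smul, smul_eq_mul, ← h1, ← mul_assoc, hε2]; ring
  have s6 : ∀ z : g, (∀ a ∈ c, ⁅a, z⁆ = 0) → killingForm k g x z = 0 := by
    intro z hz
    obtain ⟨p1, p2, p3⟩ := proj σ₁ ε₁ hi1 he1 hx1.1 (fun a ha => (hcV a ha).1) z hz
    obtain ⟨q1, q2, q3⟩ := proj σ₂ ε₂ hi2 he2 hx1.2 (fun a ha => (hcV a ha).2) _ p2
    have := s5 _ ⟨?_, q1⟩ q2
    · rw [q3, p3] at this
      simpa using this
    · generalize z + ε₁ • σ₁ z = w at p1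
      rw [map_add, map_smul, hcomm, p1, map_smul, smul_add, smul_comm ε₂ ε₁]
  refine killing_eq_zero (k := k) fun y => ?_
  refine H_induction H (fun β v hv => ?_) (map_zero _) (fun v w hv hw => ?_) y
  · by_cases hβ : ∀ a : H, (a : g) ∈ c → β a = 0
    · exact s6 v fun a ha => by
        have := hv ⟨a, hcH ha⟩
        rw [hβ ⟨a, hcH ha⟩ ha, zero_smul] at this
        exact this
    · push Not at hβ
      obtain ⟨a, ha, hne⟩ := hβ
      have h1 := killing_lie (k := k) x (a : g) v
      rw [hv a, ← lie_skew, hx2 a ha, neg_zero, map_zero, map_smul, LinearMap.zero_apply] at h1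
      exact (smul_eq_zero.1 h1.symm).resolve_left hne
  · rw [map_add, hv, hw, add_zero]

/-- existence of subspaces of maximal dimension -/
lemma exists_maxToral (V : Submodule k g) : ∃ c : Submodule k g, Toral c ∧ c ≤ V ∧
    ∀ c' : Submodule k g, Toral c' → c' ≤ V → finrank k c' ≤ finrank k c := by
  classical
  let P : ℕ → Prop := fun n => ∃ c : Submodule k g, Toral c ∧ c ≤ V ∧ finrank k c = n
  have h0 : P 0 := ⟨⊥, toral_bot, bot_le, finrank_bot k g⟩
  have hs := Nat.findGreatest_spec (P := P) (Nat.zero_le (finrank k g)) h0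
  obtain ⟨c, hc1, hc2, hc3⟩ := hs
  refine ⟨c, hc1, hc2, fun c' h1 h2 => ?_⟩
  rw [hc3]
  exact Nat.le_findGreatest (Submodule.finrank_le c') ⟨c', h1, h2, rfl⟩
end Part4

section Part5
lemma pow_eq_zero_of_nilp {T : End k g} (hT : IsNilpotent T) {i : ℕ} (hi : finrank k g + 1 ≤ i) :
    T ^ i = 0 := by
  have h1 : T ^ finrank k g = 0 := by
    have := LinearMap.aeval_self_charpoly T
    rwa [IsNilpotent.charpoly_eq_X_pow_finrank hT, map_pow, Polynomial.aeval_X] at this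
  exact pow_eq_zero_of_le (by omega) h1

lemma expEnd_apply3 {T : End k g} (hT : IsNilpotent T) {v : g} (h : T (T (T v)) = 0) :
    expEnd k g T v = v + T v + (2 : k)⁻¹ • T (T v) := by
  set n := finrank k g
  have h1 : expEnd k g T = ∑ i ∈ Finset.range (n + 4), (i.factorial : k)⁻¹ • T ^ i := by
    rw [expEnd]
    refine Finset.sum_subset (by intro i; simp only [Finset.mem_range]; omega) ?_
    intro i _ hi
    rw [pow_eq_zero_of_nilp hT (by simpa using hi), smul_zero]
  have h2 : ∑ i ∈ Finset.range 3, ((i.factorial : k)⁻¹ • T ^ i) v =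
      ∑ i ∈ Finset.range (n + 4), ((i.factorial : k)⁻¹ • T ^ i) v := by
    refine Finset.sum_subset (by intro i; simp only [Finset.mem_range]; omega) ?_
    intro i _ hi
    have : 3 ≤ i := by simpa using hi
    obtain ⟨j, rfl⟩ := Nat.exists_eq_add_of_le' this
    rw [LinearMap.smul_apply, pow_add, End.mul_apply]
    simp [pow_succ, h]
  rw [h1, LinearMap.sum_apply, ← h2]
  simp [Finset.sum_range_succ, pow_two]

lemma map_expEnd (τ : g ≃ₗ⁅k⁆ g) (x v : g) :
    τ (expEnd k g (ad k g x) v) = expEnd k g (ad k g (τ x)) (τ v) := by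
  have : ∀ (n : ℕ) (w : g), τ (((ad k g x) ^ n) w) = ((ad k g (τ x)) ^ n) (τ w) := by
    intro n
    induction n with
    | zero => simp
    | succ n ih =>
      intro w
      rw [pow_succ, pow_succ, End.mul_apply, End.mul_apply, ih]
      simp [LieEquiv.map_lie]
  simp only [expEnd, LinearMap.sum_apply, map_sum, LinearMap.smul_apply, map_smul, this]

lemma ad_map (τ : g ≃ₗ⁅k⁆ g) (x : g) :
    ad k g (τ x) = (τ.toLinearEquiv.conjAlgEquiv k) (ad k g x) := by
  ext v
  change ⁅τ x, v⁆ = τ ⁅x, τ.symm v⁆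
  rw [LieEquiv.map_lie, LieEquiv.apply_symm_apply]

lemma nilp_map (τ : g ≃ₗ⁅k⁆ g) {x : g} (hx : IsNilpotent (ad k g x)) :
    IsNilpotent (ad k g (τ x)) := by
  rw [ad_map]
  exact hx.map _

/-- the group of inner automorphisms -/
abbrev InnGrp (k : Type*) [Field k] (g : Type*) [LieRing g] [LieAlgebra k g] : Subgroup (g ≃ₗ[k] g) :=
  Subgroup.closure {e : g ≃ₗ[k] g | ∃ x : g, IsNilpotent (ad k g x) ∧
      (e : g →ₗ[k] g) = expEnd k g (ad k g x)}

lemma inn_conj (τ : g ≃ₗ⁅k⁆ g) {e : g ≃ₗ[k] g} (he : e ∈ InnGrp k g) :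
    τ.toLinearEquiv * e * τ.toLinearEquiv⁻¹ ∈ InnGrp k g := by
  induction he using Subgroup.closure_induction with
  | mem e h =>
    obtain ⟨x, hx, hex⟩ := h
    refine Subgroup.subset_closure ⟨τ x, nilp_map τ hx, ?_⟩
    ext v
    have h1 := map_expEnd τ x (τ.symm v)
    rw [LieEquiv.apply_symm_apply, ← hex] at h1
    exact h1
  | one => simp
  | mul a b _ _ ha hb => 
    have := mul_mem ha hb
    convert this using 1; group
  | inv a _ ha =>
    have := inv_mem ha
    convert this using 1; group

lemma exp_aut {x : g} (hx : IsNilpotent (ad k g x)) :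
    ∃ e : g ≃ₗ⁅k⁆ g, IsInnerAut k g e ∧ ∀ v, e v = expEnd k g (ad k g x) v := by
  let _ : Module ℚ g := Module.compHom g (algebraMap ℚ k)
  have hs : ∀ (q : ℚ) (v : g), q • v = (q : k) • v := fun q v => rfl
  let _ : LieAlgebra ℚ g := { lie_smul := fun q a b => by simp only [hs, lie_smul] }
  have hD : (LieDerivation.ad k g x).toLinearMap = ad k g x :=
    LinearMap.ext fun v => by simp
  have hx' : IsNilpotent (LieDerivation.ad k g x).toLinearMap := by rw [hD]; exact hx
  let e := LieDerivation.exp (LieDerivation.ad k g x) hx'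
  have he : ∀ v, e v = expEnd k g (ad k g x) v := by
    intro v
    have h1 := congrArg (fun f : g →ₗ[k] g => f v) (LieDerivation.exp_apply _ hx')
    rw [hD] at h1
    change e v = IsNilpotent.exp (ad k g x) v at h1
    rw [h1, IsNilpotent.exp_eq_sum (pow_eq_zero_of_nilp hx le_rfl), expEnd]
    simp only [LinearMap.sum_apply, LinearMap.smul_apply, hs]
    simp
  exact ⟨e, Subgroup.subset_closure ⟨x, hx, LinearMap.ext he⟩, he⟩

lemma isInner_trans {a b : g ≃ₗ⁅k⁆ g} (ha : IsInnerAut k g a) (hb : IsInnerAut k g b) :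
    IsInnerAut k g (a.trans b) := by
  have := (InnGrp k g).mul_mem hb ha
  exact this

lemma isInner_symm {a : g ≃ₗ⁅k⁆ g} (ha : IsInnerAut k g a) : IsInnerAut k g a.symm :=
  (InnGrp k g).inv_mem ha

lemma sl2_refl {e f h : g} (he : IsNilpotent (ad k g e)) (hf : IsNilpotent (ad k g f))
    (hef : ⁅e, f⁆ = h) (hhe : ⁅h, e⁆ = (2 : k) • e) (hhf : ⁅h, f⁆ = (-2 : k) • f) :
    ∃ n : g ≃ₗ⁅k⁆ g, IsInnerAut k g n ∧
      (∀ (y : g) (t : k), ⁅y, e⁆ = t • e → ⁅y, f⁆ = -t • f → n y = y - t • h) ∧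
      (∀ ρ : g ≃ₗ⁅k⁆ g, ρ e = e → ρ f = f → ∀ v, ρ (n v) = n (ρ v)) := by
  obtain ⟨X, hX, hX'⟩ := exp_aut he
  have hf' : IsNilpotent (ad k g (-f)) := by rw [map_neg]; exact hf.neg
  obtain ⟨Y, hY, hY'⟩ := exp_aut hf'
  have hhe' : ⁅e, h⁆ = (-2 : k) • e := by rw [← lie_skew, hhe, neg_smul]
  have hhf' : ⁅f, h⁆ = (2 : k) • f := by rw [← lie_skew, hhf, neg_smul, neg_neg]
  have hfe : ⁅f, e⁆ = -h := by rw [← lie_skew, hef]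
  refine ⟨(X.trans Y).trans X, isInner_trans (isInner_trans hX hY) hX, ?_, ?_⟩
  · intro y t hye hyf
    have hey : ⁅e, y⁆ = (-t) • e := by rw [← lie_skew, hye, neg_smul]
    have hfy : ⁅f, y⁆ = t • f := by rw [← lie_skew, hyf, neg_smul, neg_neg]
    have Xy : X y = y - t • e := by
      rw [hX', expEnd_apply3 he] <;> simp [hey, sub_eq_add_neg]
    have Xe : X e = e := by
      rw [hX', expEnd_apply3 he] <;> simp
    have Xh : X h = h - (2 : k) • e := by
      rw [hX', expEnd_apply3 he] <;> simp [hhe', sub_eq_add_neg]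
    have Yy : Y y = y - t • f := by
      rw [hY', expEnd_apply3 hf'] <;> simp [hfy, sub_eq_add_neg]
    have Ye : Y e = e + h - f := by
      rw [hY', expEnd_apply3 hf'] <;> simp [hfe, hhf', sub_eq_add_neg]
    change X (Y (X y)) = _
    rw [Xy, map_sub, map_smul, Yy, Ye]
    have : y - t • f - t • (e + h - f) = y - t • e - t • h := by module
    rw [this, map_sub, map_sub, map_smul, map_smul, Xy, Xe, Xh]
    module
  · intro ρ hρe hρf v
    have cX : ∀ v, ρ (X v) = X (ρ v) := by
      intro v; rw [hX', hX', map_expEnd, hρe]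
    have cY : ∀ v, ρ (Y v) = Y (ρ v) := by
      intro v; rw [hY', hY', map_expEnd, map_neg, hρf]
    change ρ (X (Y (X v))) = X (Y (X (ρ v)))
    rw [cX, cY, cX]

section Cartan
variable (H : LieSubalgebra k g) [H.IsCartanSubalgebra]

lemma exists_refl (α : LieModule.Weight k H g) (hα : α.IsNonZero) :
    ∃ (e f : g) (n : g ≃ₗ⁅k⁆ g), (∀ a : H, ⁅(a : g), e⁆ = α a • e) ∧
      (∀ a : H, ⁅(a : g), f⁆ = -α a • f) ∧ ⁅e, f⁆ = (IsKilling.coroot α : g) ∧ e ≠ 0 ∧ f ≠ 0 ∧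
      IsInnerAut k g n ∧ (∀ a : H, n a = a - α a • (IsKilling.coroot α : g)) ∧
      (∀ ρ : g ≃ₗ⁅k⁆ g, ρ e = e → ρ f = f → ∀ v, ρ (n v) = n (ρ v)) := by
  obtain ⟨h, e, f, ht, he, hf⟩ := IsKilling.exists_isSl2Triple_of_weight_isNonZero hα
  have hh := ht.h_eq_coroot hα he hf
  have he1 : ∀ a : H, ⁅(a : g), e⁆ = α a • e := IsKilling.lie_eq_smul_of_mem_rootSpace he
  have hf1 : ∀ a : H, ⁅(a : g), f⁆ = -α a • f := IsKilling.lie_eq_smul_of_mem_rootSpace hf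
  have hα0 : (α : H → k) ≠ 0 := hα
  obtain ⟨n, hn1, hn2, hn3⟩ := sl2_refl (k := k)
    (LieAlgebra.isNilpotent_ad_of_mem_rootSpace H hα0 he)
    (LieAlgebra.isNilpotent_ad_of_mem_rootSpace H (neg_ne_zero.2 hα0) hf) ht.lie_e_f
    (by rw [ht.lie_h_e_nsmul]; simp [two_smul]) (by rw [ht.lie_h_f_nsmul]; simp [two_smul])
  refine ⟨e, f, n, he1, hf1, by rw [ht.lie_e_f, hh], ht.e_ne_zero, ht.f_ne_zero, hn1, ?_, hn3⟩
  intro a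
  rw [hn2 a (α a) (he1 a) (hf1 a), hh]
end Cartan
end Part5

section Part6
lemma IsExpF.neg_mul {E : k → k} (hE : IsExpF E) (a : k) : E (-a) * E a = 1 := by
  rw [← hE.2, neg_add_cancel, hE.1]

section Cartan
variable (H : LieSubalgebra k g) [H.IsCartanSubalgebra]

lemma exists_D' (h : g) {E : k → k} (hE : IsExpF E) :
    ∃ D : g ≃ₗ⁅k⁆ g, ∀ (μ : k) (v : g), ⁅h, v⁆ = μ • v → D v = E μ • v := by
  obtain ⟨D, hD⟩ := exists_D (k := k) h hE
  exact ⟨D, fun μ v hv => hD μ v (mem_Wg_of_lie hv)⟩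

lemma D_symm {h : g} {E : k → k} (hE : IsExpF E) {D : g ≃ₗ⁅k⁆ g}
    (hD : ∀ (μ : k) (v : g), ⁅h, v⁆ = μ • v → D v = E μ • v) {μ : k} {v : g} (hv : ⁅h, v⁆ = μ • v) :
    D.symm v = E (-μ) • v := by
  have h1 := hD μ v hv
  have : D (E (-μ) • v) = v := by
    rw [map_smul, h1, smul_smul, hE.neg_mul, one_smul]
  rw [← this, LieEquiv.symm_apply_apply, this]

lemma inner_D {E : k → k} (hE : IsExpF E) (h : H) : ∀ (D : g ≃ₗ⁅k⁆ g),
    (∀ (μ : k) (v : g), ⁅(h : g), v⁆ = μ • v → D v = E μ • v) → IsInnerAut k g D := by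
  suffices hh : ∀ (t : k) (D : g ≃ₗ⁅k⁆ g),
    (∀ (μ : k) (v : g), ⁅((t • h : H) : g), v⁆ = μ • v → D v = E μ • v) → IsInnerAut k g D by
    intro D hD
    exact hh 1 D (by rwa [one_smul])
  have hmem : h ∈ Submodule.span k (Set.range (IsKilling.rootSystem H).coroot) := by
    rw [RootPairing.IsRootSystem.span_coroot_eq_top]; trivial
  induction hmem using Submodule.span_induction with
  | mem x hx =>
    obtain ⟨α, rfl⟩ := hx
    intro t D hD
    have hα : (α : LieModule.Weight k H g).IsNonZero :=
      (Finset.mem_filter.1 α.2).2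
    set c : H := IsKilling.coroot (α : LieModule.Weight k H g) with hc
    have hc' : (IsKilling.rootSystem H).coroot α = c := IsKilling.rootSystem_coroot_apply H α
    rw [hc'] at hD
    obtain ⟨e, f, n, -, -, -, -, -, hn, hn2, -⟩ := exists_refl H α.1 hα
    set z : H := (t / 2) • c with hz
    have hnz : n (z : g) = -(z : g) := by
      rw [hn2 z]
      have : (α : LieModule.Weight k H g) z = t := by
        rw [hz]
        have := IsKilling.root_apply_coroot hα
        change (LieModule.Weight.toLinear k H g α.1) ((t/2) • c) = t
        rw [map_smul]
        change (t/2) • (α : LieModule.Weight k H g) c = t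
        rw [hc, this]
        simp
      rw [this, ← hc, hz]
      push_cast
      module
    obtain ⟨D0, hD0⟩ := exists_D' (z : g) hE
    have key : ∀ v, D v = D0 (n (D0.symm (n.symm v))) := by
      intro v
      refine H_induction H (p := fun v => D v = D0 (n (D0.symm (n.symm v)))) ?_ (by simp) ?_ v
      · intro β v hv
        have h1 := hv z
        have h2 : ⁅(z : g), n.symm v⁆ = (-β z) • n.symm v := by
          apply n.injective
          change n _ = n _
          rw [LieEquiv.map_lie, hnz, LieEquiv.apply_symm_apply, map_smul, LieEquiv.apply_symm_apply,
            neg_lie, h1, neg_smul]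
        rw [D_symm hE hD0 h2, map_smul, LieEquiv.apply_symm_apply, map_smul, hD0 _ _ h1, smul_smul,
          neg_neg, ← hE.2]
        apply hD
        have : ((t • c : H) : g) = (2 : k) • (z : g) := by
          rw [hz]; push_cast; module
        rw [this, smul_lie, h1, smul_smul, two_mul]
      · intro a b ha hb
        simp only [map_add, ha, hb]
    have h1 : D.toLinearEquiv = (D0.toLinearEquiv * n.toLinearEquiv * D0.toLinearEquiv⁻¹) *
        n.toLinearEquiv⁻¹ := LinearEquiv.ext key
    have : D.toLinearEquiv ∈ InnGrp k g := by
      rw [h1]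
      exact mul_mem (inn_conj D0 hn) (inv_mem hn)
    exact this
  | zero =>
    intro t D hD
    have h1 : D.toLinearEquiv = 1 := LinearEquiv.ext fun v => by
      have := hD 0 v (by simp)
      rw [hE.1, one_smul] at this
      exact this
    have : D.toLinearEquiv ∈ InnGrp k g := by rw [h1]; exact one_mem _
    exact this
  | add x y _ _ hx hy =>
    intro t D hD
    obtain ⟨D1, hD1⟩ := exists_D' ((t • x : H) : g) hE
    obtain ⟨D2, hD2⟩ := exists_D' ((t • y : H) : g) hE
    have key : ∀ v, D v = D1 (D2 v) := by
      intro v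
      refine H_induction H (p := fun v => D v = D1 (D2 v)) ?_ (by simp) ?_ v
      · intro β v hv
        rw [hD2 _ _ (hv _), map_smul, hD1 _ _ (hv _), smul_smul, ← hE.2]
        apply hD
        rw [smul_add]
        push_cast
        rw [add_lie, add_smul, add_comm]
        have e1 := hv (t • x)
        have e2 := hv (t • y)
        push_cast at e1 e2
        rw [e1, e2]
      · intro a b ha hb
        simp only [map_add, ha, hb]
    have h1 : D.toLinearEquiv = D1.toLinearEquiv * D2.toLinearEquiv := LinearEquiv.ext key
    have : D.toLinearEquiv ∈ InnGrp k g := by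
      rw [h1]; exact mul_mem (hx t D1 hD1) (hy t D2 hD2)
    exact this
  | smul s x _ hx =>
    intro t D hD
    exact hx (t * s) D (by rwa [mul_smul])
end Cartan
end Part6

section Part7
/-- polynomial functions -/
def IsPolyF (f : k → k) : Prop := ∃ p : Polynomial k, ∀ t, f t = p.eval t

lemma IsPolyF.add {f h : k → k} (hf : IsPolyF f) (hh : IsPolyF h) : IsPolyF (fun t => f t + h t) := by
  obtain ⟨p, hp⟩ := hf
  obtain ⟨q, hq⟩ := hh
  exact ⟨p + q, fun t => by simp [hp, hq]⟩

lemma IsPolyF.mul {f h : k → k} (hf : IsPolyF f) (hh : IsPolyF h) : IsPolyF (fun t => f t * h t) := by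
  obtain ⟨p, hp⟩ := hf
  obtain ⟨q, hq⟩ := hh
  exact ⟨p * q, fun t => by simp [hp, hq]⟩

lemma IsPolyF.const (c : k) : IsPolyF (fun _ : k => c) := ⟨Polynomial.C c, fun t => by simp⟩

lemma IsPolyF.sum {ι : Type*} (s : Finset ι) {f : ι → k → k} (hf : ∀ i, IsPolyF (f i)) :
    IsPolyF (fun t => ∑ i ∈ s, f i t) := by
  choose p hp using hf
  exact ⟨∑ i ∈ s, p i, fun t => by simp [hp, Polynomial.eval_finsetSum]⟩

/-- polynomial curves -/
def PV {V : Type*} [AddCommGroup V] [Module k V] (y : k → V) : Prop :=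
  ∀ l : Module.Dual k V, IsPolyF (fun t => l (y t))

section PVs
variable {V W : Type*} [AddCommGroup V] [Module k V] [AddCommGroup W] [Module k W]

lemma PV.add {y z : k → V} (hy : PV y) (hz : PV z) : PV (fun t => y t + z t) := fun l => by
  simpa using (hy l).add (hz l)

lemma PV.smul {f : k → k} {y : k → V} (hf : IsPolyF f) (hy : PV y) : PV (fun t => f t • y t) :=
  fun l => by simpa using hf.mul (hy l)

lemma PV.const (v : V) : PV (fun _ : k => v) := fun l => IsPolyF.const (l v)

lemma PV.lin (A : V →ₗ[k] W) {y : k → V} (hy : PV y) : PV (fun t => A (y t)) :=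
  fun l => hy (l.comp A)

lemma PV.sum {ι : Type*} (s : Finset ι) {f : ι → k → V} (hf : ∀ i, PV (f i)) :
    PV (fun t => ∑ i ∈ s, f i t) := fun l => by
  simpa using IsPolyF.sum s (fun i => hf i l)

lemma PV.apply [FiniteDimensional k V] {F : k → V →ₗ[k] W} (hF : ∀ v, PV (fun t => F t v)) {y : k → V} (hy : PV y) :
    PV (fun t => F t (y t)) := by
  let b := finBasis k V
  have : ∀ t, F t (y t) = ∑ i, (b.coord i (y t)) • F t (b i) := by
    intro t
    conv_lhs => rw [← b.sum_repr (y t), map_sum]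
    simp only [map_smul, Basis.coord_apply]
  simp only [this]
  exact PV.sum _ fun i => PV.smul (hy (b.coord i)) (hF (b i))

lemma PV.indep {ι : Type*} [Fintype ι] {y : ι → k → V} (hy : ∀ i, PV (y i)) (t₀ : k)
    (hli : LinearIndependent k (fun i => y i t₀)) :
    ∃ p : Polynomial k, p ≠ 0 ∧ ∀ t, p.eval t ≠ 0 → LinearIndependent k (fun i => y i t) := by
  classical
  have hinj : Function.Injective (Fintype.linearCombination k (fun i => y i t₀)) :=
    linearIndependent_iff_injective_fintypeLinearCombination.1 hli
  obtain ⟨π, hπ⟩ := LinearMap.exists_leftInverse_of_injective _ (LinearMap.ker_eq_bot.2 hinj)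
  have hc : ∀ i j, IsPolyF (fun t => π (y j t) i) := fun i j =>
    hy j ((LinearMap.proj i).comp π)
  choose P hP using hc
  have hdet : ∀ t, (Matrix.det (Matrix.of P)).eval t = Matrix.det (Matrix.of fun i j => π (y j t) i) := by
    intro t
    rw [← Polynomial.coe_evalRingHom, RingHom.map_det]
    congr 1
    ext i j
    simp [hP]
  refine ⟨Matrix.det (Matrix.of P), ?_, ?_⟩
  · intro h0
    have h1 := hdet t₀
    have : (Matrix.of fun i j => π (y j t₀) i) = 1 := by
      ext i j
      have := LinearMap.congr_fun hπ (Pi.single j 1)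
      simp [Fintype.linearCombination_apply_single] at this
      simp [this, Matrix.one_apply, Pi.single_apply]
    rw [h0, this] at h1
    simp at h1
  · intro t ht
    rw [hdet] at ht
    have := Matrix.linearIndependent_cols_of_det_ne_zero ht
    exact LinearIndependent.of_comp π this

lemma semicont [FiniteDimensional k V] [FiniteDimensional k W] (L : k → V →ₗ[k] W)
    (hL : ∀ v, PV (fun t => L t v)) {ι : Type*} [Fintype ι] (y : ι → k → V) (hy : ∀ i, PV (y i))
    (hker : ∀ i t, L t (y i t) = 0) (h0 : LinearIndependent k (fun i => y i 0)) :
    Fintype.card ι ≤ finrank k (LinearMap.ker (L 1)) := by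
  obtain ⟨p, hp0, hp⟩ := PV.indep hy 0 h0
  let b := finBasis k (LinearMap.range (L 1))
  have hb : ∀ i, ∃ u, L 1 u = (b i : W) := fun i => (b i).2
  choose u hu using hb
  obtain ⟨q, hq0, hq⟩ := PV.indep (y := fun i t => L t (u i)) (fun i => hL (u i)) 1 (by
    simp only [hu]
    exact b.linearIndependent.map' (LinearMap.range (L 1)).subtype (Submodule.ker_subtype _))
  obtain ⟨t, ht⟩ : ∃ t, (p * q).eval t ≠ 0 := by
    by_contra! h
    exact mul_ne_zero hp0 hq0 (Polynomial.funext (by simpa using h))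
  rw [Polynomial.eval_mul] at ht
  have h1 := hp t (left_ne_zero_of_mul ht)
  have h2 := hq t (right_ne_zero_of_mul ht)
  have h3 : LinearIndependent k (fun i => (⟨y i t, hker i t⟩ : LinearMap.ker (L t))) :=
    LinearIndependent.of_comp (LinearMap.ker (L t)).subtype h1
  have h4 : LinearIndependent k (fun i => (⟨L t (u i), u i, rfl⟩ : LinearMap.range (L t))) :=
    LinearIndependent.of_comp (LinearMap.range (L t)).subtype h2
  have h5 := h3.fintype_card_le_finrank
  have h6 := h4.fintype_card_le_finrank
  have h7 := LinearMap.finrank_range_add_finrank_ker (L t)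
  have h8 := LinearMap.finrank_range_add_finrank_ker (L 1)
  simp only [Fintype.card_fin] at h6
  omega
end PVs

/-- the adjoint-dual map -/
lemma exists_dualE : ∃ d : End k g →ₗ[k] g, (∀ (A : End k g) (x : g),
    killingForm k g x (d A) = LinearMap.trace k g (ad k g x * A)) := by
  have hnd := LieAlgebra.IsKilling.killingForm_nondegenerate k g
  let B : LinearMap.BilinForm k g := killingForm k g
  let T : End k g →ₗ[k] Module.Dual k g :=
    LinearMap.mk₂ k (fun A x => LinearMap.trace k g (ad k g x * A))
      (by intro A A' x; simp [mul_add]) (by intro c A x; simp) (by intro A x x'; simp [add_mul])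
      (by intro c A x; simp)
  refine ⟨(LinearMap.BilinForm.toDual B hnd).symm.toLinearMap.comp T, ?_⟩
  intro A x
  rw [LieModule.traceForm_comm]
  change B ((LinearMap.BilinForm.toDual B hnd).symm (T A)) x = _
  rw [LinearMap.BilinForm.apply_toDual_symm_apply]
  rfl

lemma dualE_ad {d : End k g →ₗ[k] g} (hd : ∀ (A : End k g) (x : g),
    killingForm k g x (d A) = LinearMap.trace k g (ad k g x * A)) (y : g) : d (ad k g y) = y := by
  have := LieAlgebra.IsKilling.killingForm_nondegenerate k g
  apply sub_eq_zero.1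
  apply this.2
  intro x
  rw [map_sub, hd, sub_eq_zero]
  rfl

lemma dualE_conj {d : End k g →ₗ[k] g} (hd : ∀ (A : End k g) (x : g),
    killingForm k g x (d A) = LinearMap.trace k g (ad k g x * A)) (τ : g ≃ₗ⁅k⁆ g) {A A' : End k g}
    (h : ∀ v, τ (A v) = A' (τ v)) : τ (d A) = d A' := by
  have := LieAlgebra.IsKilling.killingForm_nondegenerate k g
  apply sub_eq_zero.1
  apply this.2
  intro x
  rw [map_sub, hd, sub_eq_zero]
  obtain ⟨x, rfl⟩ := τ.surjective x
  have h1 := LieAlgebra.killingForm_of_equiv_apply τ x (d A)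
  change killingForm k g (τ x) (τ (d A)) = LinearMap.trace k g (ad k g (τ x) * A')
  rw [h1, hd]
  have hA : A' = τ.toLinearEquiv.conjAlgEquiv k A := by
    ext v
    change A' v = τ (A (τ.symm v))
    rw [h, LieEquiv.apply_symm_apply]
  rw [ad_map, hA, ← map_mul]
  exact (LinearMap.trace_conj' _ _).symm

lemma dualE_PV {d : End k g →ₗ[k] g} (hd : ∀ (A : End k g) (x : g),
    killingForm k g x (d A) = LinearMap.trace k g (ad k g x * A)) {F : k → End k g}
    (hF : ∀ v, PV (fun t => F t v)) : PV (fun t => d (F t)) := by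
  have hnd := LieAlgebra.IsKilling.killingForm_nondegenerate k g
  let B : LinearMap.BilinForm k g := killingForm k g
  intro l
  have h1 : ∀ t, l (d (F t)) = LinearMap.trace k g
      (ad k g ((LinearMap.BilinForm.toDual B hnd).symm l) * F t) := by
    intro t
    rw [← hd]
    exact (LinearMap.BilinForm.apply_toDual_symm_apply (hB := hnd) l (d (F t))).symm
  let b := finBasis k g
  simp only [h1, LinearMap.trace_eq_matrix_trace k b, Matrix.trace, Matrix.diag]
  refine IsPolyF.sum _ fun i => ?_
  simp only [LinearMap.toMatrix_apply]
  exact PV.lin (ad k g _) (hF (b i)) (b.coord i)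

lemma symm_PV {F : k → g ≃ₗ⁅k⁆ g} (hF : ∀ v, PV (fun t => F t v)) (v : g) :
    PV (fun t => (F t).symm v) := by
  have hnd := LieAlgebra.IsKilling.killingForm_nondegenerate k g
  let B : LinearMap.BilinForm k g := killingForm k g
  intro l
  set x := (LinearMap.BilinForm.toDual B hnd).symm l
  have h1 : ∀ t, l ((F t).symm v) = B v (F t x) := by
    intro t
    have h2 : B x ((F t).symm v) = l ((F t).symm v) :=
      LinearMap.BilinForm.apply_toDual_symm_apply (hB := hnd) l _
    rw [← h2]
    have h3 := LieAlgebra.killingForm_of_equiv_apply (F t) x ((F t).symm v)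
    rw [LieEquiv.apply_symm_apply] at h3
    exact h3.symm.trans (LieModule.traceForm_comm k g g _ _)
  simp only [h1]
  exact hF x (B v)
end Part7

section Part8
lemma toral_D {c : Submodule k g} (hc : Toral c) : ∃ D : g ≃ₗ⁅k⁆ g, IsInnerAut k g D ∧
    (∀ x, (∀ y ∈ c, ⁅y, x⁆ = 0) → D x = x) ∧
    (∀ τ : g ≃ₗ⁅k⁆ g, (∀ y ∈ c, τ y = y) → ∀ v, τ (D v) = D (τ v)) ∧
    (∀ τ : g ≃ₗ⁅k⁆ g, (∀ y ∈ c, τ y = -y) → ∀ v, τ (D v) = D.symm (τ v)) ∧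
    (∀ y ∈ c, ∃ G : Polynomial k,
      ∀ v, Polynomial.aeval ((D.toLinearEquiv : End k g) ^ 4) G v = ⁅y, v⁆) := by
  classical
  obtain ⟨H, hH, hcH⟩ := hc
  let _ := Fintype.ofFinite (LieModule.Weight k H g)
  let c' : Submodule k H := c.comap H.toSubmodule.subtype
  let ι := {p : LieModule.Weight k H g × LieModule.Weight k H g //
    ∃ y ∈ c', (p.1.toLinear k H g - p.2.toLinear k H g) y ≠ 0}
  obtain ⟨h, hhc, hh⟩ := Module.Dual.exists_forall_mem_ne_zero_of_forall_exists c'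
    (fun p : ι => (p.1.1.toLinear k H g - p.1.2.toLinear k H g)) (fun p => p.2)
  have hgen : ∀ β γ : LieModule.Weight k H g, β h = γ h → ∀ y ∈ c', β y = γ y := by
    intro β γ hβ y hy
    by_contra hne
    have := hh ⟨(β, γ), y, hy, by simpa [sub_eq_zero] using hne⟩
    apply this
    simpa [sub_eq_zero] using hβ
  obtain ⟨E, hE, hE1⟩ := exists_exp_sep (k := k)
    ((Finset.univ.image (fun p : LieModule.Weight k H g × LieModule.Weight k H g =>
      4 * (p.1 h - p.2 h))).erase 0) (fun s hs => (Finset.mem_erase.1 hs).1)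
  have hsep : ∀ β γ : LieModule.Weight k H g, E (4 * β h) = E (4 * γ h) → β h = γ h := by
    intro β γ he
    by_contra hne
    have h1 : (4 : k) * (β h - γ h) ≠ 0 := mul_ne_zero (by norm_num) (sub_ne_zero.2 hne)
    have h2 := hE1 (4 * (β h - γ h)) (Finset.mem_erase.2 ⟨h1, Finset.mem_image.2
      ⟨(β, γ), Finset.mem_univ _, rfl⟩⟩)
    apply h2
    rw [mul_sub, sub_eq_add_neg, hE.2, he, mul_comm, hE.neg_mul]
  obtain ⟨D, hD⟩ := exists_D' (h : g) hE
  refine ⟨D, inner_D H hE h D hD, ?_, ?_, ?_, ?_⟩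
  · intro x hx
    rw [hD 0 x (by rw [hx h hhc, zero_smul]), hE.1, one_smul]
  · intro τ hτ v
    refine H_induction H (p := fun v => τ (D v) = D (τ v)) ?_ (by simp) ?_ v
    · intro β v hv
      rw [hD _ _ (hv h), map_smul, hD (β h)]
      conv_lhs => rw [← hτ h hhc]
      rw [← LieEquiv.map_lie, hv, map_smul]
    · intro a b ha hb
      simp only [map_add, ha, hb]
  · intro τ hτ v
    refine H_induction H (p := fun v => τ (D v) = D.symm (τ v)) ?_ (by simp) ?_ v
    · intro β v hv
      rw [hD _ _ (hv h), map_smul, D_symm hE hD (μ := - β h), neg_neg]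
      have : (h : g) = - τ h := by rw [hτ h hhc, neg_neg]
      conv_lhs => rw [this]
      rw [neg_lie, ← LieEquiv.map_lie, hv, map_smul, neg_smul]
    · intro a b ha hb
      simp only [map_add, ha, hb]
  · intro y hy
    let r : k → k := fun x => if hx : ∃ β : LieModule.Weight k H g, E (4 * β h) = x then
      hx.choose ⟨y, hcH hy⟩ else 0
    have hr : ∀ β : LieModule.Weight k H g, r (E (4 * β h)) = β ⟨y, hcH hy⟩ := by
      intro β
      have hx : ∃ γ : LieModule.Weight k H g, E (4 * γ h) = E (4 * β h) := ⟨β, rfl⟩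
      simp only [r, dif_pos hx]
      exact hgen _ _ (hsep _ _ hx.choose_spec) _ hy
    refine ⟨Lagrange.interpolate (Finset.univ.image fun β : LieModule.Weight k H g => E (4 * β h)) id r, ?_⟩
    intro v
    refine H_induction H (p := fun v => (Polynomial.aeval ((D.toLinearEquiv : End k g) ^ 4) _ v = ⁅y, v⁆)) ?_ (by simp) ?_ v
    · intro β v hv
      have h1 : D v = E (β h) • v := hD _ _ (hv h)
      have h2 : ((D.toLinearEquiv : End k g) ^ 4) v = E (4 * β h) • v := by
        have h1' : (D.toLinearEquiv : End k g) v = E (β h) • v := h1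
        have : E (4 * β h) = E (β h) * (E (β h) * (E (β h) * E (β h))) := by
          rw [← hE.2, ← hE.2, ← hE.2]; congr 1; ring
        rw [this]
        simp only [pow_succ, pow_zero, one_mul, End.mul_apply, h1', map_smul, smul_smul]
      have h3 := Module.End.aeval_apply_of_hasEigenvector (p := Lagrange.interpolate
        (Finset.univ.image fun β : LieModule.Weight k H g => E (4 * β h)) id r)
        (f := (D.toLinearEquiv : End k g) ^ 4) (μ := E (4 * β h)) (x := v)
      by_cases hv0 : v = 0
      · simp [hv0]
      rw [h3 ⟨End.mem_eigenspace_iff.2 h2, hv0⟩]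
      have h4 := Lagrange.eval_interpolate_at_node (v := id) (r := r) (i := E (4 * β h))
        (s := Finset.univ.image fun β : LieModule.Weight k H g => E (4 * β h))
        (Function.injective_id.injOn) (Finset.mem_image_of_mem _ (Finset.mem_univ _))
      simp only [id] at h4
      rw [h4, hr]
      exact (hv ⟨y, hcH hy⟩).symm
    · intro a b ha hb
      simp only [map_add, lie_add, ha, hb]

lemma expEnd_zero (v : g) : expEnd k g (ad k g (0 : g)) v = v := by
  rw [expEnd_apply3] <;> simp

lemma exists_curve {e : g ≃ₗ⁅k⁆ g} (he : IsInnerAut k g e) :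
    ∃ F : k → g ≃ₗ⁅k⁆ g, (∀ v, PV (fun t => F t v)) ∧ (∀ v, F 0 v = v) ∧ ∀ v, F 1 v = e v := by
  have : ∀ e ∈ InnGrp k g, ∃ F : k → g ≃ₗ⁅k⁆ g, (∀ v, PV (fun t => F t v)) ∧ (∀ v, F 0 v = v) ∧
      ∀ v, F 1 v = e v := by
    intro e he
    induction he using Subgroup.closure_induction with
    | mem e h =>
      obtain ⟨x, hx, hex⟩ := h
      have h1 : ∀ t : k, IsNilpotent (ad k g (t • x)) := by
        intro t; rw [map_smul]; exact hx.smul t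
      choose F hF hF' using fun t => exp_aut (h1 t)
      refine ⟨F, ?_, ?_, ?_⟩
      · intro v
        simp only [hF', expEnd, LinearMap.sum_apply, map_smul, smul_pow, LinearMap.smul_apply]
        refine PV.sum _ fun i => ?_
        refine PV.smul (IsPolyF.const _) (PV.smul ⟨Polynomial.X ^ i, by simp⟩ (PV.const _))
      · intro v
        rw [hF', zero_smul, expEnd_zero]
      · intro v
        rw [hF', one_smul, ← hex]; rfl
    | one => exact ⟨fun _ => LieEquiv.refl, fun v => PV.const v, fun v => rfl, fun v => rfl⟩
    | mul a b _ _ ha hb =>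
      obtain ⟨F, h1, h2, h3⟩ := ha
      obtain ⟨F', h1', h2', h3'⟩ := hb
      refine ⟨fun t => (F' t).trans (F t), fun v => ?_, fun v => ?_, fun v => ?_⟩
      · exact PV.apply (F := fun t => ((F t).toLinearEquiv : g →ₗ[k] g)) h1 (h1' v)
      · change F 0 (F' 0 v) = v
        rw [h2', h2]
      · change F 1 (F' 1 v) = a (b v)
        rw [h3', h3]
    | inv a _ ha =>
      obtain ⟨F, h1, h2, h3⟩ := ha
      refine ⟨fun t => (F t).symm, fun v => symm_PV h1 v, fun v => ?_, fun v => ?_⟩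
      · change (F 0).symm v = v
        apply (F 0).injective
        change F 0 _ = F 0 _
        rw [LieEquiv.apply_symm_apply, h2]
      · change (F 1).symm v = a.symm v
        apply (F 1).injective
        change F 1 _ = F 1 _
        rw [LieEquiv.apply_symm_apply, h3, LinearEquiv.apply_symm_apply]
  exact this _ he
end Part8

section Part9
lemma aeval_PV {T : k → End k g} (hT : ∀ v, PV (fun t => T t v)) (G : Polynomial k) :
    ∀ v, PV (fun t => Polynomial.aeval (T t) G v) := by
  induction G using Polynomial.induction_on' with
  | add p q hp hq =>
    intro v
    simp only [map_add, LinearMap.add_apply]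
    exact (hp v).add (hq v)
  | monomial n a =>
    have h1 : ∀ (n : ℕ) v, PV (fun t => (T t ^ n) v) := by
      intro n
      induction n with
      | zero => intro v; simpa using PV.const v
      | succ n ih =>
        intro v
        simp only [pow_succ, End.mul_apply]
        exact PV.apply ih (hT v)
    intro v
    simp only [Polynomial.aeval_monomial, Module.algebraMap_end_eq_smul_id, End.mul_apply,
      LinearMap.smul_apply, LinearMap.id_apply]
    exact PV.smul (IsPolyF.const a) (h1 n v)

lemma aeval_conj {T T' : End k g} {τ : g ≃ₗ⁅k⁆ g} (h : ∀ v, τ (T v) = T' (τ v)) (G : Polynomial k) :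
    ∀ v, τ (Polynomial.aeval T G v) = Polynomial.aeval T' G (τ v) := by
  induction G using Polynomial.induction_on' with
  | add p q hp hq =>
    intro v
    simp only [map_add, LinearMap.add_apply, hp, hq]
  | monomial n a =>
    have h1 : ∀ (n : ℕ) v, τ ((T ^ n) v) = (T' ^ n) (τ v) := by
      intro n
      induction n with
      | zero => intro v; simp
      | succ n ih =>
        intro v
        simp only [pow_succ, End.mul_apply]
        rw [ih, h]
    intro v
    simp only [Polynomial.aeval_monomial, Module.algebraMap_end_eq_smul_id, End.mul_apply,
      LinearMap.smul_apply, LinearMap.id_apply, map_smul, h1]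

lemma aeval_fix {T : End k g} {v : g} (h : T v = v) (G : Polynomial k) :
    Polynomial.aeval T G v = G.eval 1 • v := by
  by_cases hv : v = 0
  · simp [hv]
  exact Module.End.aeval_apply_of_hasEigenvector ⟨End.mem_eigenspace_iff.2 (by rw [h, one_smul]), hv⟩

lemma dim_le {σ₁ σ₂ ψ : g ≃ₗ⁅k⁆ g} (h1 : ∀ x, σ₁ (σ₁ x) = x) (h2 : ∀ x, σ₂ (σ₂ x) = x)
    (hcomm : ∀ x, σ₁ (σ₂ x) = σ₂ (σ₁ x)) (hψ : IsInnerAut k g ψ)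
    (hψ' : ∀ x, σ₂ x = ψ (σ₁ (ψ.symm x))) {c a : Submodule k g} (hc : Toral c)
    (hc1 : ∀ y ∈ c, σ₁ y = -y) (hc2 : ∀ y ∈ c, σ₂ y = -y)
    (hmax : ∀ x, (∀ y ∈ c, ⁅y, x⁆ = 0) → σ₁ x = -x → σ₂ x = -x → x ∈ c)
    (ha : Toral a) (ha1 : ∀ y ∈ a, σ₁ y = -y) : finrank k a ≤ finrank k c := by
  obtain ⟨A, hA, -, -, hA2, hA3⟩ := toral_D ha
  obtain ⟨C, hC, hC0, hC1, hC2, hC3⟩ := toral_D hc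
  obtain ⟨F, hF, hF0, hF1⟩ := exists_curve (isInner_trans (isInner_trans hA hψ) hC)
  have hF1' : ∀ v, F 1 v = C (ψ (A v)) := hF1
  obtain ⟨d, hd⟩ := exists_dualE (k := k) (g := g)
  let Ψ : k → g ≃ₗ⁅k⁆ g := fun t => A.symm.trans (F t)
  have hΨ : ∀ v, PV (fun t => Ψ t v) := fun v => hF (A.symm v)
  have hΨs := symm_PV hΨ
  let S : k → g ≃ₗ⁅k⁆ g := fun t => ((Ψ t).symm.trans σ₁).trans (Ψ t)
  have hSapp : ∀ t v, S t v = Ψ t (σ₁ ((Ψ t).symm v)) := fun t v => rfl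
  have hS : ∀ v, PV (fun t => S t v) := by
    intro v
    exact PV.apply (F := fun t => ((Ψ t).toLinearEquiv : g →ₗ[k] g)) hΨ
      (PV.lin (σ₁.toLinearEquiv : g →ₗ[k] g) (hΨs v))
  have hSS : ∀ t v, S t (S t v) = v := by
    intro t v
    rw [hSapp, hSapp, LieEquiv.symm_apply_apply, h1, LieEquiv.apply_symm_apply]
  let L : k → g →ₗ[k] g × g := fun t => ((σ₁.toLinearEquiv : g →ₗ[k] g) + LinearMap.id).prod
    (((S t).toLinearEquiv : g →ₗ[k] g) + LinearMap.id)
  have hLapp : ∀ t v, L t v = (σ₁ v + v, S t v + v) := fun t v => rfl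
  have hL : ∀ v, PV (fun t => L t v) := by
    intro v
    have : ∀ t, L t v = LinearMap.inl k g g (σ₁ v + v) + LinearMap.inr k g g (S t v + v) := by
      intro t; rw [hLapp]; simp
    simp only [this]
    exact (PV.const _).add (PV.lin _ ((hS v).add (PV.const v)))
  let p : k → End k g := fun t => (σ₁.toLinearEquiv : End k g) * ((S t).toLinearEquiv : End k g)
  let q : k → End k g := fun t => ((S t).toLinearEquiv : End k g) * (σ₁.toLinearEquiv : End k g)
  have hpapp : ∀ t v, p t v = σ₁ (S t v) := fun t v => rfl
  have hqapp : ∀ t v, q t v = S t (σ₁ v) := fun t v => rfl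
  have hp : ∀ v, PV (fun t => p t v) := fun v => PV.lin (σ₁.toLinearEquiv : g →ₗ[k] g) (hS v)
  have hq : ∀ v, PV (fun t => q t v) := fun v => hS (σ₁ v)
  let b := finBasis k a
  choose G hG using fun i => hA3 (b i) (b i).2
  let G' := fun i => (G i).comp (Polynomial.X ^ 2)
  let Q : Fin (finrank k a) → k → End k g := fun i t =>
    Polynomial.aeval (p t) (G' i) + (-1 : k) • Polynomial.aeval (q t) (G' i)
  have hQ : ∀ i v, PV (fun t => Q i t v) := fun i v =>
    (aeval_PV hp (G' i) v).add (PV.smul (IsPolyF.const (-1)) (aeval_PV hq (G' i) v))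
  let y : Fin (finrank k a) → k → g := fun i t => (2 : k)⁻¹ • d (Q i t)
  have hy : ∀ i, PV (y i) := fun i => PV.smul (IsPolyF.const _) (dualE_PV hd (hQ i))
  have hsym : ∀ (τ : g ≃ₗ⁅k⁆ g) t, (∀ v, τ (p t v) = q t (τ v)) → (∀ v, τ (q t v) = p t (τ v)) →
      ∀ i, τ (y i t) + y i t = 0 := by
    intro τ t e1 e2 i
    have : τ (d (Q i t)) = d (-Q i t) := by
      apply dualE_conj hd
      intro v
      simp only [Q, LinearMap.add_apply, LinearMap.smul_apply, map_add, map_smul,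
        LinearMap.neg_apply, aeval_conj e1, aeval_conj e2]
      module
    simp only [y, map_smul, this, map_neg]
    module
  have hker : ∀ i t, L t (y i t) = 0 := by
    intro i t
    rw [hLapp, Prod.mk_eq_zero]
    refine ⟨hsym σ₁ t (fun v => ?_) (fun v => ?_) i, hsym (S t) t (fun v => ?_) (fun v => ?_) i⟩
    · rw [hpapp, hqapp, h1, h1]
    · rw [hpapp, hqapp]
    · rw [hpapp, hqapp]
    · rw [hpapp, hqapp, hSS, hSS]
  have hA2' : ∀ v, σ₁ (A.symm v) = A (σ₁ v) := by
    intro v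
    have := hA2 σ₁ ha1 (A.symm v)
    rw [LieEquiv.apply_symm_apply] at this
    rw [this, LieEquiv.apply_symm_apply]
  have hΨ0 : ∀ v, Ψ 0 v = A.symm v := fun v => hF0 _
  have hΨ0s : ∀ v, (Ψ 0).symm v = A v := by
    intro v
    apply (Ψ 0).injective
    change Ψ 0 _ = Ψ 0 _
    rw [LieEquiv.apply_symm_apply, hΨ0, LieEquiv.symm_apply_apply]
  have hp0 : p 0 = (A.toLinearEquiv : End k g) ^ 2 := by
    ext v
    rw [hpapp, hSapp, hΨ0s, hΨ0, hA2', h1, pow_two]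
    rfl
  have hpy : ∀ i v, Polynomial.aeval (p 0) (G' i) v = ⁅(b i : g), v⁆ := by
    intro i v
    rw [← hG i v]
    simp only [G']
    rw [Polynomial.aeval_comp, map_pow, Polynomial.aeval_X, hp0, ← pow_mul]
  have hqy : ∀ i v, Polynomial.aeval (q 0) (G' i) v = - ⁅(b i : g), v⁆ := by
    intro i v
    have := aeval_conj (τ := σ₁) (T := p 0) (T' := q 0) (by
      intro v
      rw [hpapp, hqapp, h1, h1]) (G' i) (σ₁ v)
    rw [h1, hpy, LieEquiv.map_lie, h1, ha1 _ (b i).2, neg_lie] at this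
    exact this.symm
  have hy0 : ∀ i, y i 0 = b i := by
    intro i
    have : Q i 0 = (2 : k) • ad k g (b i) := by
      ext v
      simp only [Q, LinearMap.add_apply, LinearMap.smul_apply, hpy, hqy, ad_apply]
      module
    simp only [y, this, map_smul, dualE_ad hd]
    rw [smul_smul, inv_mul_cancel₀ two_ne_zero, one_smul]
  have hfin := semicont L hL y hy hker (by
    simp only [hy0]
    exact b.linearIndependent.map' a.subtype (Submodule.ker_subtype _))
  rw [Fintype.card_fin] at hfin
  refine hfin.trans (Submodule.finrank_mono ?_)
  intro x hx
  rw [LinearMap.mem_ker, hLapp, Prod.mk_eq_zero] at hx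
  have e1 : σ₁ x = -x := eq_neg_of_add_eq_zero_left hx.1
  have e2 : S 1 x = -x := eq_neg_of_add_eq_zero_left hx.2
  have hΨ1 : ∀ v, Ψ 1 v = C (ψ v) := by
    intro v
    change F 1 (A.symm v) = _
    rw [hF1', LieEquiv.apply_symm_apply]
  have hΨ1s : ∀ v, (Ψ 1).symm v = ψ.symm (C.symm v) := by
    intro v
    apply (Ψ 1).injective
    change Ψ 1 _ = Ψ 1 _
    rw [LieEquiv.apply_symm_apply, hΨ1, LieEquiv.apply_symm_apply, LieEquiv.apply_symm_apply]
  rw [hSapp, hΨ1s, hΨ1, ← hψ'] at e2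
  let θ := σ₁.trans σ₂
  have hθapp : ∀ v, θ v = σ₂ (σ₁ v) := fun v => rfl
  have hθθ : ∀ v, θ (θ v) = v := by
    intro v; rw [hθapp, hθapp, hcomm, h2, h1]
  have hθC := hC1 θ (by
    intro y hy; rw [hθapp, hc1 y hy, map_neg, hc2 y hy, neg_neg])
  have e3 : C (C (θ x)) = x := by
    have := hC2 σ₂ hc2 (C.symm x)
    rw [LieEquiv.apply_symm_apply] at this
    rw [hθapp, e1, map_neg, map_neg, map_neg, this, LieEquiv.apply_symm_apply, e2, neg_neg]
  have e4 : C (C x) = θ x := by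
    have := congrArg θ e3
    rwa [hθC, hθC, hθθ] at this
  have h4 : ∀ v, C (C (C (C v))) = v → ((C.toLinearEquiv : End k g) ^ 4) v = v := by
    intro v hv
    exact hv
  have hcc := ((toral_iff c).1 hc).1
  have hxz : ∀ y ∈ c, ⁅y, x⁆ = 0 := by
    intro y hy
    obtain ⟨G, hG⟩ := hC3 y hy
    have f1 := hG x
    rw [aeval_fix (h4 x (by rw [e4, e3]))] at f1
    have f2 := hG y
    have hCy : C y = y := hC0 y (fun z hz => hcc z hz y hy)
    rw [aeval_fix (h4 y (by simp only [hCy])), lie_self] at f2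
    rcases smul_eq_zero.1 f2 with f | f
    · rw [← f1, f, zero_smul]
    · rw [f, zero_lie]
  refine hmax x hxz e1 ?_
  have hCx := hC0 x hxz
  rw [hCx, hCx, hθapp, e1, map_neg] at e4
  rw [eq_neg_iff_add_eq_zero, add_comm, ← eq_neg_iff_add_eq_zero]
  exact e4
end Part9

section Part10
lemma dyad_c {σ₁ σ₂ : g ≃ₗ⁅k⁆ g} (h : IsDyad k g σ₁ σ₂) : ∃ c : Submodule k g, Toral c ∧
    (∀ y ∈ c, σ₁ y = -y) ∧ (∀ y ∈ c, σ₂ y = -y) ∧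
    ∀ x, (∀ y ∈ c, ⁅y, x⁆ = 0) → (σ₁ x = -x ∨ σ₂ x = -x) → x ∈ c := by
  obtain ⟨h1, h2, -, hcomm, ψ, hψ, hψ'⟩ := h
  have e0 : ∀ τ : g ≃ₗ⁅k⁆ g, ∀ x, x ∈ eigSub k g τ (-1) ↔ τ x = (-1 : k) • x := fun τ x =>
    End.mem_eigenspace_iff
  obtain ⟨c, hc, hcV, hcmax⟩ := exists_maxToral (eigSub k g σ₁ (-1) ⊓ eigSub k g σ₂ (-1))
  have hcV' : ∀ x ∈ c, σ₁ x = (-1 : k) • x ∧ σ₂ x = (-1 : k) • x := fun x hx =>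
    ⟨(e0 _ _).1 (hcV hx).1, (e0 _ _).1 (hcV hx).2⟩
  have hc1 : ∀ y ∈ c, σ₁ y = -y := fun y hy => by rw [(hcV' y hy).1]; simp
  have hc2 : ∀ y ∈ c, σ₂ y = -y := fun y hy => by rw [(hcV' y hy).2]; simp
  have hmax : ∀ x, (∀ y ∈ c, ⁅y, x⁆ = 0) → σ₁ x = -x → σ₂ x = -x → x ∈ c := by
    intro x hx e1 e2
    refine maxToral σ₁ σ₂ h1 h2 hcomm (.inr rfl) (.inr rfl) c hcV' hc ?_
      (by simp [e1, e2]) hx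
    intro c' hc' hV hle
    have := hcmax c' hc' (fun x hx => ⟨(e0 _ _).2 (hV x hx).1, (e0 _ _).2 (hV x hx).2⟩)
    exact (Submodule.eq_of_le_of_finrank_le hle this).ge
  have key : ∀ τ : g ≃ₗ⁅k⁆ g, (∀ x, τ (τ x) = x) → (∀ y ∈ c, τ y = -y) →
      (∀ a : Submodule k g, Toral a → (∀ y ∈ a, τ y = -y) → finrank k a ≤ finrank k c) →
      ∀ x, (∀ y ∈ c, ⁅y, x⁆ = 0) → τ x = -x → x ∈ c := by
    intro τ hτ hτc hdim x hx hτx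
    refine maxToral τ LieEquiv.refl hτ (fun _ => rfl) (fun _ => rfl) (ε₁ := -1) (ε₂ := 1)
      (.inr rfl) (.inl rfl) c (fun y hy => ⟨by simp [hτc y hy], by simp⟩) hc ?_
      ⟨by simp [hτx], by simp⟩ hx
    intro c' hc' hV hle
    have := hdim c' hc' (fun y hy => by rw [(hV y hy).1]; simp)
    exact (Submodule.eq_of_le_of_finrank_le hle this).ge
  refine ⟨c, hc, hc1, hc2, ?_⟩
  rintro x hx (e | e)
  · exact key σ₁ h1 hc1 (fun a ha ha1 => dim_le h1 h2 hcomm hψ hψ' hc hc1 hc2 hmax ha ha1) x hx e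
  · refine key σ₂ h2 hc2 (fun a ha ha1 => dim_le (σ₁ := σ₂) (σ₂ := σ₁) h2 h1
      (fun x => (hcomm x).symm) (isInner_symm hψ) ?_ hc hc2 hc1
      (fun x hx e2 e1 => hmax x hx e1 e2) ha ha1) x hx e
    intro x
    change σ₁ x = ψ.symm (σ₂ (ψ x))
    rw [hψ', LieEquiv.symm_apply_apply, LieEquiv.symm_apply_apply]

lemma dyad_z {σ₁ σ₂ : g ≃ₗ⁅k⁆ g} (h1 : ∀ x, σ₁ (σ₁ x) = x) (h2 : ∀ x, σ₂ (σ₂ x) = x)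
    (hcomm : ∀ x, σ₁ (σ₂ x) = σ₂ (σ₁ x)) {c : Submodule k g}
    (hc1 : ∀ y ∈ c, σ₁ y = -y) (hc2 : ∀ y ∈ c, σ₂ y = -y)
    (hm : ∀ x, (∀ y ∈ c, ⁅y, x⁆ = 0) → (σ₁ x = -x ∨ σ₂ x = -x) → x ∈ c) :
    ∀ x, (∀ y ∈ c, ⁅y, x⁆ = 0) → x - σ₁ x ∈ c ∧ σ₁ (σ₂ x) = x := by
  have hz : ∀ τ : g ≃ₗ⁅k⁆ g, (∀ y ∈ c, τ y = -y) → ∀ x, (∀ y ∈ c, ⁅y, x⁆ = 0) →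
      ∀ y ∈ c, ⁅y, τ x⁆ = 0 := by
    intro τ hτ x hx y hy
    have : y = τ (-y) := by rw [map_neg, hτ y hy, neg_neg]
    rw [this, ← LieEquiv.map_lie, neg_lie, hx y hy, neg_zero, map_zero]
  have m1 : ∀ x, (∀ y ∈ c, ⁅y, x⁆ = 0) → x - σ₁ x ∈ c := by
    intro x hx
    refine hm _ (fun y hy => by rw [lie_sub, hx y hy, hz σ₁ hc1 x hx y hy, sub_zero]) (.inl ?_)
    rw [map_sub, h1]; abel
  have m2 : ∀ x, (∀ y ∈ c, ⁅y, x⁆ = 0) → x - σ₂ x ∈ c := by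
    intro x hx
    refine hm _ (fun y hy => by rw [lie_sub, hx y hy, hz σ₂ hc2 x hx y hy, sub_zero]) (.inr ?_)
    rw [map_sub, h2]; abel
  intro x hx
  refine ⟨m1 x hx, ?_⟩
  set w := x + σ₁ x with hw
  have hwz : ∀ y ∈ c, ⁅y, w⁆ = 0 := fun y hy => by
    rw [lie_add, hx y hy, hz σ₁ hc1 x hx y hy, add_zero]
  have hw1 : σ₁ w = w := by rw [hw, map_add, h1, add_comm]
  have hw2 : w - σ₂ w = 0 := by
    have h3 := hc1 _ (m2 w hwz)
    rw [map_sub, hcomm, hw1] at h3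
    have h4 : (2 : k) • (w - σ₂ w) = 0 := by
      rw [two_smul]; nth_rewrite 1 [h3]; abel
    exact (smul_eq_zero.1 h4).resolve_left two_ne_zero
  have hx2 : (2 : k) • x = w + (x - σ₁ x) := by rw [hw, two_smul]; abel
  have h5 : (2 : k) • σ₁ (σ₂ x) = (2 : k) • x := by
    rw [← map_smul, ← map_smul, hx2, map_add, map_add, ← sub_eq_zero.1 hw2, hw1,
      hc2 _ (m1 x hx), map_neg, hc1 _ (m1 x hx), neg_neg]
  exact smul_right_injective g (two_ne_zero (α := k)) h5

lemma exists_base {ι M N M' : Type*} [Finite ι] [AddCommGroup M] [Module k M] [AddCommGroup N]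
    [Module k N] [AddCommGroup M'] [Module k M'] (P : RootPairing ι k M N) [P.IsRootSystem]
    [P.IsCrystallographic] [P.IsReduced] (r : M →ₗ[k] M') (S : M →ₗ[k] M)
    (hr : ∀ x, r (S x) = - r x) (hS : ∀ i, ∃ j, P.root j = S (P.root i)) :
    ∃ b : P.Base, ∀ i ∈ b.support, r (P.root i) ≠ 0 →
      - S (P.root i) ∈ AddSubmonoid.closure (P.root '' b.support) := by
  classical
  let _ := Fintype.ofFinite ι
  let _i : Module ℚ M := Module.compHom M (algebraMap ℚ k)
  let _i' : Module ℚ M' := Module.compHom M' (algebraMap ℚ k)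
  obtain ⟨f1, hf1⟩ : ∃ f : Dual ℚ M, ∀ i, f (P.root i) ≠ 0 :=
    exists_dual_forall_apply_ne_zero P.root <| by simp [P.ne_zero]
  obtain ⟨f0, hf0⟩ : ∃ f : Dual ℚ M', ∀ i : {i // r (P.root i) ≠ 0}, f (r (P.root i.1)) ≠ 0 :=
    exists_dual_forall_apply_ne_zero (fun i : {i // r (P.root i) ≠ 0} => r (P.root i.1)) fun i => i.2
  let Nn : ℚ := ∑ i, (|f1 (P.root i)| + 1) / |f0 (r (P.root i))|
  let f : M →+ ℚ := (AddMonoidHom.mulLeft Nn).comp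
    ((f0 : M' →+ ℚ).comp (r : M →+ M')) + (f1 : M →+ ℚ)
  have hfapp : ∀ x, f x = Nn * f0 (r x) + f1 x := fun x => rfl
  have hN : ∀ i, r (P.root i) ≠ 0 → |f1 (P.root i)| < |Nn * f0 (r (P.root i))| := by
    intro i hi
    have h0 : 0 < |f0 (r (P.root i))| := abs_pos.2 (hf0 ⟨i, hi⟩)
    have h1 : (|f1 (P.root i)| + 1) / |f0 (r (P.root i))| ≤ Nn :=
      Finset.single_le_sum (f := fun i => (|f1 (P.root i)| + 1) / |f0 (r (P.root i))|)
        (fun j _ => by positivity) (Finset.mem_univ i)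
    rw [div_le_iff₀ h0] at h1
    have h2 : Nn * |f0 (r (P.root i))| ≤ |Nn * f0 (r (P.root i))| := by
      rw [abs_mul]; gcongr; exact le_abs_self _
    linarith
  have hf : ∀ i, f (P.root i) ≠ 0 := by
    intro i
    rw [hfapp]
    by_cases hi : r (P.root i) = 0
    · rw [hi, map_zero, mul_zero, zero_add]; exact hf1 i
    · intro h0
      have := hN i hi
      rw [eq_neg_of_add_eq_zero_left h0, abs_neg] at this
      exact lt_irrefl _ this
  let := P.indexNeg
  refine ⟨RootPairing.Base.mk' P (IsAddIndecomposable.baseOf P.root f)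
    (P.linearIndepOn_root_baseOf f hf)
    (fun i ↦ IsAddIndecomposable.mem_or_neg_mem_closure_baseOf P.root f i (hf i) (by simp)), ?_⟩
  intro i hi hri
  have hsupp : (((RootPairing.Base.mk' P (IsAddIndecomposable.baseOf P.root f)
    (P.linearIndepOn_root_baseOf f hf)
    (fun i ↦ IsAddIndecomposable.mem_or_neg_mem_closure_baseOf P.root f i (hf i) (by simp))).support
      : Finset ι) : Set ι) = IsAddIndecomposable.baseOf P.root f := by
    simp [RootPairing.Base.mk']
  rw [hsupp, AddSubmonoid.closure_image_isAddIndecomposable_baseOf]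
  have hi' : i ∈ IsAddIndecomposable.baseOf P.root f := by rw [← hsupp]; exact hi
  have hpos : 0 < f (P.root i) := hi'.1
  obtain ⟨j, hj⟩ := hS i
  have hrj : r (P.root j) = - r (P.root i) := by rw [hj, hr]
  have hNi := hN i hri
  have hNj := hN j (by rw [hrj]; exact neg_ne_zero.2 hri)
  rw [hfapp] at hpos
  have hjneg : f (P.root j) < 0 := by
    rw [hfapp]
    rw [hrj, map_neg, mul_neg, abs_neg] at hNj
    rw [hrj, map_neg, mul_neg]
    set A := Nn * f0 (r (P.root i))
    rcases abs_cases A with ⟨h, h'⟩ | ⟨h, h'⟩ <;> rw [h] at hNi hNj <;>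
      have a1 := abs_lt.1 hNi <;> have a2 := abs_lt.1 hNj <;> linarith [a1.1, a1.2, a2.1, a2.2]
  apply AddSubmonoid.subset_closure
  refine ⟨-j, ?_, by rw [← hj]; simp⟩
  change 0 < f (P.root (-j))
  simp only [RootPairing.indexNeg_neg, RootPairing.root_reflectionPerm, RootPairing.reflection_apply_self, map_neg]
  linarith
end Part10

section Part11
def IsWt (H : LieSubalgebra k g) (l : Dual k H) (v : g) : Prop := ∀ a : H, ⁅(a : g), v⁆ = l a • v

section Cartan
variable (H : LieSubalgebra k g) [H.IsCartanSubalgebra]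

lemma root_nz (i : H.root) : (i : LieModule.Weight k H g).IsNonZero := (Finset.mem_filter.1 i.2).2

lemma isWt_iff (i : H.root) (v : g) : IsWt H ((IsKilling.rootSystem H).root i) v ↔
    v ∈ rootSpace H (i : LieModule.Weight k H g) := by
  constructor
  · intro h
    apply LieModule.weightSpace_le_genWeightSpace
    rw [LieModule.mem_weightSpace]
    intro a
    have := h a
    simpa using this
  · intro h a
    have := IsKilling.lie_eq_smul_of_mem_rootSpace h a
    simpa using this

lemma wt_root {l : Dual k H} {v : g} (hv : v ≠ 0) (h : IsWt H l v) (hl : l ≠ 0) :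
    ∃ i : H.root, (IsKilling.rootSystem H).root i = l := by
  have h1 : v ∈ LieModule.genWeightSpace g (l : H → k) := by
    apply LieModule.weightSpace_le_genWeightSpace
    rw [LieModule.mem_weightSpace]
    exact h
  let w : LieModule.Weight k H g := ⟨l, fun hb => hv (by rw [hb] at h1; simpa using h1)⟩
  refine ⟨⟨w, ?_⟩, ?_⟩
  · refine Finset.mem_filter.2 ⟨Finset.mem_univ _, fun hz => hl ?_⟩
    ext a
    exact congrFun hz a
  · ext a
    rw [IsKilling.rootSystem_root_apply]
    rfl

lemma wt_exists (i : H.root) : ∃ v : g, v ≠ 0 ∧ IsWt H ((IsKilling.rootSystem H).root i) v := by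
  obtain ⟨e, f, n, he, -, -, h0, -⟩ := exists_refl H i.1 (root_nz H i)
  refine ⟨e, h0, fun a => ?_⟩
  rw [he a, IsKilling.rootSystem_root_apply]
  rfl

lemma wt_smul {i : H.root} {v w : g} (hv : v ≠ 0) (h : IsWt H ((IsKilling.rootSystem H).root i) v)
    (hw : IsWt H ((IsKilling.rootSystem H).root i) w) : ∃ t : k, w = t • v := by
  rw [isWt_iff] at h hw
  have h1 := IsKilling.finrank_rootSpace_eq_one i.1 (root_nz H i)
  obtain ⟨t, ht⟩ := (finrank_eq_one_iff_of_nonzero' (⟨v, h⟩ : rootSpace H i.1)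
    (fun h0 => hv (congrArg Subtype.val h0))).1 h1 ⟨w, hw⟩
  exact ⟨t, (congrArg Subtype.val ht).symm⟩

lemma wt_induction {p : g → Prop} (hH : ∀ a ∈ H, p a)
    (hR : ∀ (i : H.root) (v : g), IsWt H ((IsKilling.rootSystem H).root i) v → p v)
    (hadd : ∀ a b, p a → p b → p (a + b)) (v : g) : p v := by
  refine H_induction H (p := p) ?_ (hH 0 H.zero_mem) hadd v
  intro β v hv
  by_cases hb : β.IsZero
  · apply hH
    apply H_self H
    intro a ha
    have := hv ⟨a, ha⟩
    rw [show β ⟨a, ha⟩ = 0 from congrFun hb _, zero_smul] at this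
    exact this
  · refine hR ⟨β, Finset.mem_filter.2 ⟨Finset.mem_univ _, hb⟩⟩ v fun a => ?_
    rw [hv a, IsKilling.rootSystem_root_apply]
    rfl

lemma fix_all (b : (IsKilling.rootSystem H).Base) (ρ : g ≃ₗ⁅k⁆ g) (hρ : ∀ a ∈ H, ρ a = a)
    (hs : ∀ i ∈ b.support, ∀ v, IsWt H ((IsKilling.rootSystem H).root i) v → ρ v = v) :
    ∀ v, ρ v = v := by
  let P := IsKilling.rootSystem H
  have hP : P = IsKilling.rootSystem H := rfl
  have hw : ∀ (l : Dual k H) v, IsWt H l v → IsWt H l (ρ v) := by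
    intro l v hv a
    have := congrArg ρ (hv a)
    rwa [LieEquiv.map_lie, hρ _ a.2, map_smul] at this
  have key : ∀ i : H.root, ∀ v, IsWt H (P.root i) v → ρ v = v := by
    intro i
    refine b.induction_reflect i (p := fun i => ∀ v, IsWt H (P.root i) v → ρ v = v) ?_ hs ?_
    · intro i hi v hv
      obtain ⟨e, f, n, he, hf, hef, he0, hf0, -⟩ := exists_refl H i.1 (root_nz H i)
      have he' : IsWt H (P.root i) e := fun a => by
        rw [he a, hP, IsKilling.rootSystem_root_apply]; rfl
      have hf' : IsWt H (P.root (P.reflectionPerm i i)) f := fun a => by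
        rw [hf a, RootPairing.root_reflectionPerm, RootPairing.reflection_apply_self, hP,
          IsKilling.rootSystem_root_apply]; simp
      obtain ⟨u, hu⟩ := wt_smul H hf0 hf' (hw _ _ hf')
      obtain ⟨t, rfl⟩ := wt_smul H hf0 hf' hv
      have h1 := congrArg ρ hef
      rw [LieEquiv.map_lie, hi e he', hρ _ (IsKilling.coroot i.1).2, hu, lie_smul, hef] at h1
      have hc : (IsKilling.coroot i.1 : g) ≠ 0 := fun h0 => by
        have h2 : (IsKilling.coroot i.1 : H) = 0 := Subtype.ext h0
        have h3 := IsKilling.root_apply_coroot (root_nz H i)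
        rw [h2] at h3
        have h4 : (LieModule.Weight.toLinear k H g i.1) 0 = 2 := h3
        simp at h4
      have hu1 : u = 1 := by
        have : (u - 1) • (IsKilling.coroot i.1 : g) = 0 := by rw [sub_smul, h1, one_smul, sub_self]
        rcases smul_eq_zero.1 this with h | h
        · exact sub_eq_zero.1 h
        · exact absurd h hc
      rw [map_smul, hu, hu1, one_smul]
    · intro i j hi hj v hv
      obtain ⟨e, f, n, he, hf, hef, he0, hf0, -, hn, hn2⟩ := exists_refl H j.1 (root_nz H j)
      have he' : IsWt H (P.root j) e := fun a => by
        rw [he a, hP, IsKilling.rootSystem_root_apply]; rfl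
      have hf' : IsWt H (P.root (P.reflectionPerm j j)) f := fun a => by
        rw [hf a, RootPairing.root_reflectionPerm, RootPairing.reflection_apply_self, hP,
          IsKilling.rootSystem_root_apply]; simp
      have hre := hs j hj e he'
      have hrf : ρ f = f := by
        obtain ⟨u, hu⟩ := wt_smul H hf0 hf' (hw _ _ hf')
        have h1 := congrArg ρ hef
        rw [LieEquiv.map_lie, hre, hρ _ (IsKilling.coroot j.1).2, hu, lie_smul, hef] at h1
        have hc : (IsKilling.coroot j.1 : g) ≠ 0 := fun h0 => by
          have h2 : (IsKilling.coroot j.1 : H) = 0 := Subtype.ext h0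
          have h3 := IsKilling.root_apply_coroot (root_nz H j)
          rw [h2] at h3
          have h4 : (LieModule.Weight.toLinear k H g j.1) 0 = 2 := h3
          simp at h4
        have : (u - 1) • (IsKilling.coroot j.1 : g) = 0 := by rw [sub_smul, h1, one_smul, sub_self]
        rcases smul_eq_zero.1 this with h | h
        · rw [hu, sub_eq_zero.1 h, one_smul]
        · exact absurd h hc
      have hcm := hn2 ρ hre hrf
      have hv' : IsWt H (P.root i) (n.symm v) := by
        intro a
        apply n.injective
        change n _ = n _
        rw [LieEquiv.map_lie, hn a, LieEquiv.apply_symm_apply, map_smul, LieEquiv.apply_symm_apply]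
        have h1 := hv (a - (j.1 a) • (IsKilling.coroot j.1))
        push_cast at h1
        rw [h1]
        congr 1
        have h2 : P.root j (IsKilling.coroot j.1) = 2 := by
          rw [hP, IsKilling.rootSystem_root_apply]
          exact IsKilling.root_apply_coroot (root_nz H j)
        have h3 : P.root j a = j.1 a := by
          rw [hP, IsKilling.rootSystem_root_apply]; rfl
        rw [RootPairing.root_reflectionPerm, RootPairing.reflection_apply]
        simp only [LinearMap.sub_apply, LinearMap.smul_apply, map_sub, map_smul, h2, h3, smul_eq_mul]
        have h4 : P.toLinearMap (P.root i) (P.coroot j) = P.root i (IsKilling.coroot j.1) := by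
          rw [hP, IsKilling.rootSystem_coroot_apply]; rfl
        have h5 : P.coroot' j (P.root i) = P.root i (IsKilling.coroot j.1) := h4
        rw [h5]
        ring
      have h6 := hcm (n.symm v)
      rw [hi _ hv', LieEquiv.apply_symm_apply] at h6
      exact h6
  exact wt_induction H (p := fun v => ρ v = v) hρ key (fun a b ha hb => by rw [map_add, ha, hb])

end Cartan
end Part11

section Part12
lemma comb {V W : Type*} [AddCommGroup V] [Module k V] [AddCommGroup W] [Module k W]
    (Δ : Set (Dual k V)) (S : Dual k V →ₗ[k] Dual k V) (r : Dual k V →ₗ[k] W) (y h : V)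
    (hΔ : ∀ l ∈ Δ, (r l = 0 ∧ l y = 0 ∧ l h = 0) ∨ (r l ≠ 0 ∧ l y = 1 ∧ (l h = 0 ∨ l h = 1) ∧
      -S l ∈ AddSubmonoid.closure Δ))
    (rS : ∀ l, r (S l) = -r l) (SS : ∀ l, S (S l) = l) (Sr : ∀ l, r l = 0 → S l = l)
    {l : Dual k V} (hl : l ∈ Δ) (hr : r l ≠ 0) : (-S l) h = 0 ∨ (-S l) h = 1 := by
  have c0 : ∀ l ∈ AddSubmonoid.closure Δ, ∃ m : ℕ, l y = m ∧ (m = 0 → r l = 0) := by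
    intro l hl
    induction hl using AddSubmonoid.closure_induction with
    | mem x hx =>
      rcases hΔ x hx with h | h
      · exact ⟨0, by simp [h.2.1], fun _ => h.1⟩
      · exact ⟨1, by simp [h.2.1], fun h => by simp at h⟩
    | zero => exact ⟨0, by simp, fun _ => by simp⟩
    | add a b _ _ ha hb =>
      obtain ⟨m, e, f⟩ := ha
      obtain ⟨m', e', f'⟩ := hb
      refine ⟨m + m', by simp [e, e'], fun h => ?_⟩
      rw [map_add, f (by omega), f' (by omega), add_zero]
  have c1 : ∀ l ∈ AddSubmonoid.closure Δ, ∃ m n : ℕ, l y = m ∧ (-S l) y = n ∧ m ≤ n := by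
    intro l hl
    induction hl using AddSubmonoid.closure_induction with
    | mem x hx =>
      rcases hΔ x hx with h | h
      · exact ⟨0, 0, by simp [h.2.1], by rw [Sr x h.1]; simp [h.2.1], le_rfl⟩
      · obtain ⟨n, e, f⟩ := c0 _ h.2.2.2
        refine ⟨1, n, by simp [h.2.1], e, Nat.one_le_iff_ne_zero.2 fun h0 => h.1 ?_⟩
        have := f h0
        rwa [map_neg, rS, neg_neg] at this
    | zero => exact ⟨0, 0, by simp, by simp, le_rfl⟩
    | add a b _ _ ha hb =>
      obtain ⟨m, n, e, f, hmn⟩ := ha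
      obtain ⟨m', n', e', f', hmn'⟩ := hb
      refine ⟨m + m', n + n', by simp [e, e'], ?_, by omega⟩
      rw [map_add, neg_add, LinearMap.add_apply, f, f']
      push_cast; rfl
  have c2 : ∀ l ∈ AddSubmonoid.closure Δ, ∃ m p : ℕ, l y = m ∧ l h = p ∧ p ≤ m := by
    intro l hl
    induction hl using AddSubmonoid.closure_induction with
    | mem x hx =>
      rcases hΔ x hx with h | h
      · exact ⟨0, 0, by simp [h.2.1], by simp [h.2.2], le_rfl⟩
      · rcases h.2.2.1 with h' | h'
        · exact ⟨1, 0, by simp [h.2.1], by simp [h'], by omega⟩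
        · exact ⟨1, 1, by simp [h.2.1], by simp [h'], by omega⟩
    | zero => exact ⟨0, 0, by simp, by simp, le_rfl⟩
    | add a b _ _ ha hb =>
      obtain ⟨m, n, e, f, hmn⟩ := ha
      obtain ⟨m', n', e', f', hmn'⟩ := hb
      exact ⟨m + m', n + n', by simp [e, e'], by simp [f, f'], by omega⟩
  rcases hΔ l hl with h0 | h0
  · exact absurd h0.1 hr
  obtain ⟨m, n, e, f, hmn⟩ := c1 _ h0.2.2.2
  obtain ⟨m', p, e', f', hpm⟩ := c2 _ h0.2.2.2
  rw [map_neg, neg_neg, SS, h0.2.1] at f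
  have hn : n = 1 := by exact_mod_cast f.symm
  have hm : m = m' := by exact_mod_cast e.symm.trans e'
  have : p = 0 ∨ p = 1 := by omega
  rcases this with rfl | rfl
  · left; simpa using f'
  · right; simpa using f'

section Cartan
variable (H : LieSubalgebra k g) [H.IsCartanSubalgebra]

lemma base_dual (b : (IsKilling.rootSystem H).Base) (f : H.root → k) :
    ∃ h : H, ∀ i ∈ b.support, (IsKilling.rootSystem H).root i h = f i := by
  refine ⟨(Module.evalEquiv k H).symm (b.toWeightBasis.constr k (fun i => f i)), fun i hi => ?_⟩
  rw [Module.apply_evalEquiv_symm_apply]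
  have := b.toWeightBasis.constr_basis k (fun i => f i) ⟨i, hi⟩
  rwa [RootPairing.Base.toWeightBasis_apply] at this

lemma base_sep (b : (IsKilling.rootSystem H).Base) (h : H)
    (hh : ∀ i ∈ b.support, (IsKilling.rootSystem H).root i h = 0) : h = 0 := by
  rw [← Module.forall_dual_apply_eq_zero_iff k]
  intro l
  have : Dual.eval k H h = 0 := b.toWeightBasis.ext fun i => by
    rw [RootPairing.Base.toWeightBasis_apply]
    exact hh i i.2
  exact LinearMap.congr_fun this l

lemma main_aux {σ₁ σ₂ : g ≃ₗ⁅k⁆ g} (h1 : ∀ x, σ₁ (σ₁ x) = x) (h2 : ∀ x, σ₂ (σ₂ x) = x)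
    (hcomm : ∀ x, σ₁ (σ₂ x) = σ₂ (σ₁ x)) {c : Submodule k g} (hcH : c ≤ H.toSubmodule)
    (hc1 : ∀ y ∈ c, σ₁ y = -y)
    (hz : ∀ x, (∀ y ∈ c, ⁅y, x⁆ = 0) → x - σ₁ x ∈ c ∧ σ₁ (σ₂ x) = x) :
    ∃ φ : g ≃ₗ⁅k⁆ g, IsInnerAut k g φ ∧ (∀ x, σ₁ (σ₂ x) = φ (φ x)) ∧
      (∀ x, σ₁ (φ x) = φ.symm (σ₁ x)) := by
  classical
  let P := IsKilling.rootSystem H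
  have hzH : ∀ a ∈ H, a - σ₁ a ∈ c ∧ σ₁ (σ₂ a) = a := fun a ha =>
    hz a fun y hy => H_comm H (hcH hy) ha
  have hσH : ∀ a ∈ H, σ₁ a ∈ H := by
    intro a ha
    have := H.sub_mem ha (hcH (hzH a ha).1)
    rwa [sub_sub_cancel] at this
  let θ : g ≃ₗ⁅k⁆ g := σ₂.trans σ₁
  have hθ : ∀ x, θ x = σ₁ (σ₂ x) := fun _ => rfl
  have hθH : ∀ a ∈ H, θ a = a := fun a ha => (hzH a ha).2
  have hθθ : ∀ x, θ (θ x) = x := fun x => by rw [hθ, hθ, ← hcomm, h1, h2]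
  have hθσ : ∀ x, θ (σ₁ x) = σ₁ (θ x) := fun x => by rw [hθ, hθ, ← hcomm]
  let s : H →ₗ[k] H :=
    { toFun := fun a => ⟨σ₁ a, hσH a a.2⟩
      map_add' := fun a b => Subtype.ext (by simp)
      map_smul' := fun t a => Subtype.ext (by simp) }
  have hs : ∀ a : H, ((s a : H) : g) = σ₁ a := fun _ => rfl
  have hss : ∀ a, s (s a) = a := fun a => Subtype.ext (h1 a)
  let S : Dual k H →ₗ[k] Dual k H := s.dualMap
  have hSa : ∀ l a, S l a = l (s a) := fun _ _ => rfl
  let c' : Submodule k H := c.comap H.toSubmodule.subtype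
  let r : Dual k H →ₗ[k] Dual k c' := c'.subtype.dualMap
  have hra : ∀ l (a : c'), r l a = l a := fun _ _ => rfl
  have hrS : ∀ l, r (S l) = -r l := by
    intro l
    ext a
    have : s a = -a := Subtype.ext (hc1 a a.2)
    rw [hra, hSa, this, LinearMap.neg_apply, hra, map_neg]
  have hSS : ∀ l, S (S l) = l := fun l => by ext a; rw [hSa, hSa, hss]
  have hSr : ∀ l, r l = 0 → S l = l := by
    intro l hl
    ext a
    have h3 : a - s a ∈ c' := (hzH a a.2).1
    have h4 : l (a - s a) = 0 := LinearMap.congr_fun hl ⟨_, h3⟩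
    rw [map_sub, sub_eq_zero] at h4
    exact h4.symm
  have hwσ : ∀ l v, IsWt H l v → IsWt H (S l) (σ₁ v) := by
    intro l v hv a
    have := congrArg σ₁ (hv (s a))
    rwa [LieEquiv.map_lie, hs, h1, map_smul] at this
  have hwθ : ∀ l v, IsWt H l v → IsWt H l (θ v) := by
    intro l v hv a
    have := congrArg θ (hv a)
    rwa [LieEquiv.map_lie, hθH _ a.2, map_smul] at this
  have hχ : ∀ i : H.root, ∃ χ : k, (χ = 1 ∨ χ = -1) ∧ ∀ v, IsWt H (P.root i) v → θ v = χ • v := by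
    intro i
    obtain ⟨e, he0, he⟩ := wt_exists H i
    obtain ⟨t, ht⟩ := wt_smul H he0 he (hwθ _ _ he)
    refine ⟨t, ?_, ?_⟩
    · have h3 := hθθ e
      rw [ht, map_smul, ht, smul_smul] at h3
      have h4 : (t * t - 1) • e = 0 := by rw [sub_smul, h3, one_smul, sub_self]
      have h5 := (smul_eq_zero.1 h4).resolve_right he0
      exact mul_self_eq_one_iff.1 (sub_eq_zero.1 h5)
    · intro v hv
      obtain ⟨u, rfl⟩ := wt_smul H he0 he hv
      rw [map_smul, ht, smul_comm]
  choose χ hχ1 hχ2 using hχ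
  have hχr : ∀ i, r (P.root i) = 0 → χ i = 1 := by
    intro i hi
    obtain ⟨e, he0, he⟩ := wt_exists H i
    have h3 : θ e = e := (hz e fun y hy => by
      have h4 := he ⟨y, hcH hy⟩
      have h5 : P.root i ⟨y, hcH hy⟩ = 0 := LinearMap.congr_fun hi ⟨⟨y, hcH hy⟩, hy⟩
      rw [h5, zero_smul] at h4
      exact h4).2
    rw [hχ2 i e he] at h3
    have h4 : (χ i - 1) • e = 0 := by rw [sub_smul, h3, one_smul, sub_self]
    exact sub_eq_zero.1 ((smul_eq_zero.1 h4).resolve_right he0)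
  have hS : ∀ i, ∃ j, P.root j = S (P.root i) := by
    intro i
    obtain ⟨e, he0, he⟩ := wt_exists H i
    refine wt_root H (v := σ₁ e) ?_ (hwσ _ _ he) ?_
    · intro h3
      apply he0
      rw [← h1 e, h3, map_zero]
    · intro h3
      have h4 := hSS (P.root i)
      rw [h3, map_zero] at h4
      exact P.ne_zero i h4.symm
  obtain ⟨b, hb⟩ := exists_base P r S hrS hS
  obtain ⟨h, hh⟩ := base_dual H b (fun i => if χ i = 1 then 0 else 1)
  obtain ⟨y, hy⟩ := base_dual H b (fun i => if r (P.root i) = 0 then 0 else 1)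
  have hn11 : (-1 : k) ≠ 1 := by
    intro h3
    have : (2 : k) = 0 := by linear_combination -h3
    exact two_ne_zero this
  obtain ⟨I, hI⟩ := IsAlgClosed.exists_pow_nat_eq (-1 : k) (n := 2) (by norm_num)
  have hI0 : I ≠ 0 := by
    rintro rfl
    norm_num at hI
  obtain ⟨E, hE, hE1⟩ := exists_exp (k := k) one_ne_zero (Units.mk0 I hI0)
  have hE1' : E 1 = I := hE1
  have hE2 : E (1 + 1) = -1 := by rw [hE.2, hE1', ← hI, sq]
  have hEm2 : E (-(1 + 1)) = -1 := by
    have := hE.neg_mul (1 + 1)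
    rw [hE2] at this
    linear_combination -this
  obtain ⟨φ, hφ⟩ := exists_D' (h : g) hE
  have hφ2 : ∀ l v, IsWt H l v → φ (φ v) = E (l h + l h) • v := by
    intro l v hv
    rw [hφ _ _ (hv h), map_smul, hφ _ _ (hv h), smul_smul, hE.2]
  have hφH : ∀ a ∈ H, φ a = a := by
    intro a ha
    rw [hφ 0 a (by rw [H_comm H h.2 ha, zero_smul]), hE.1, one_smul]
  have hχE : ∀ i ∈ b.support, χ i = E (P.root i h + P.root i h) := by
    intro i hi
    rw [hh i hi]
    rcases hχ1 i with h3 | h3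
    · rw [if_pos h3, add_zero, hE.1, h3]
    · rw [if_neg (by rw [h3]; exact hn11), hE2, h3]
  let ρ : g ≃ₗ⁅k⁆ g := (θ.trans φ.symm).trans φ.symm
  have hρ : ∀ v, ρ v = φ.symm (φ.symm (θ v)) := fun _ => rfl
  have hρ' : ∀ v, θ v = φ (φ v) → ρ v = v := fun v hv => by
    rw [hρ, hv, LieEquiv.symm_apply_apply, LieEquiv.symm_apply_apply]
  have hρ1 : ∀ v, ρ v = v := by
    refine fix_all H b ρ (fun a ha => hρ' a ?_) (fun i hi v hv => hρ' v ?_)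
    · rw [hθH a ha, hφH a ha, hφH a ha]
    · rw [hχ2 i v hv, hφ2 _ v hv, hχE i hi]
  have hθφ : ∀ v, θ v = φ (φ v) := by
    intro v
    have := congrArg φ (congrArg φ (hρ1 v))
    rwa [hρ, LieEquiv.apply_symm_apply, LieEquiv.apply_symm_apply] at this
  have hsh : s h = -h := by
    rw [← add_eq_zero_iff_eq_neg]
    refine base_sep H b _ fun i hi => ?_
    rw [map_add]
    change S (P.root i) h + P.root i h = 0
    by_cases hr : r (P.root i) = 0
    · have h3 : P.root i h = 0 := by
        rw [hh i hi, if_pos (hχr i hr)]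
      rw [hSr _ hr, h3, add_zero]
    · have h3 := comb (P.root '' b.support) S r y h (by
        rintro _ ⟨j, hj, rfl⟩
        have e1 := hh j hj
        have e2 := hy j hj
        by_cases hrj : r (P.root j) = 0
        · left
          rw [if_pos (hχr j hrj)] at e1
          rw [if_pos hrj] at e2
          exact ⟨hrj, e2, e1⟩
        · right
          rw [if_neg hrj] at e2
          refine ⟨hrj, e2, ?_, hb j hj hrj⟩
          by_cases hx : χ j = 1
          · left; rwa [if_pos hx] at e1
          · right; rwa [if_neg hx] at e1) hrS hSS hSr ⟨i, hi, rfl⟩ hr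
      obtain ⟨e, he0, he⟩ := wt_exists H i
      have h4 : χ i = E (S (P.root i) h + S (P.root i) h) := by
        have e1 := hφ2 _ _ (hwσ _ _ he)
        rw [← hθφ, hθσ, hχ2 i e he, map_smul] at e1
        have hne : σ₁ e ≠ 0 := fun h3 => he0 (by rw [← h1 e, h3, map_zero])
        have e2 : (χ i - E (S (P.root i) h + S (P.root i) h)) • σ₁ e = 0 := by
          rw [sub_smul, e1, sub_self]
        exact sub_eq_zero.1 ((smul_eq_zero.1 e2).resolve_right hne)
      have h5 := hh i hi
      rw [LinearMap.neg_apply] at h3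
      rcases h3 with h3 | h3
      · have h6 : S (P.root i) h = 0 := neg_eq_zero.1 h3
        rw [h6, add_zero, hE.1] at h4
        rw [if_pos h4] at h5
        rw [h6, zero_add]; exact h5
      · have h6 : S (P.root i) h = -1 := by rw [← h3, neg_neg]
        rw [h6, show (-1 : k) + -1 = -(1 + 1) by ring, hEm2] at h4
        rw [if_neg (by rw [h4]; exact hn11)] at h5
        rw [h6]
        change -1 + P.root i h = 0
        rw [show P.root i h = 1 from h5]; ring
  have hσh : σ₁ (h : g) = -(h : g) := congrArg Subtype.val hsh
  refine ⟨φ, inner_D H hE h φ hφ, hθφ, ?_⟩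
  intro x
  refine H_induction H (p := fun v => σ₁ (φ v) = φ.symm (σ₁ v)) ?_ (by simp) ?_ x
  · intro β v hv
    have h3 : ⁅(h : g), σ₁ v⁆ = (-β h) • σ₁ v := by
      have := congrArg σ₁ (hv h)
      rw [LieEquiv.map_lie, hσh, neg_lie, map_smul] at this
      rw [neg_smul, ← this, neg_neg]
    rw [hφ _ _ (hv h), map_smul, D_symm hE hφ h3, neg_neg]
  · intro a b ha hb
    simp only [map_add, ha, hb]

end Cartan

lemma dyad_final (σ₁ σ₂ : g ≃ₗ⁅k⁆ g) (h : IsDyad k g σ₁ σ₂) :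
    ∃ φ : g ≃ₗ⁅k⁆ g, IsInnerAut k g φ ∧ (∀ x, φ (φ (φ (φ x))) = x) ∧
      (∀ x, σ₂ x = φ (σ₁ (φ.symm x))) ∧ (∀ x, σ₁ (σ₂ x) = φ (φ x)) := by
  obtain ⟨c, hc, hc1, hc2, hm⟩ := dyad_c h
  obtain ⟨h1, h2, -, hcomm, -⟩ := h
  obtain ⟨H, hH, hcH⟩ := hc
  obtain ⟨φ, hφ, hφ2, hφσ⟩ := main_aux H h1 h2 hcomm hcH hc1 (dyad_z h1 h2 hcomm hc1 hc2 hm)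
  refine ⟨φ, hφ, fun x => ?_, fun x => ?_, hφ2⟩
  · rw [← hφ2, ← hφ2, ← hcomm, h1, h2]
  · have h3 : σ₁ (φ.symm x) = φ (σ₁ x) := by
      have := hφσ (φ.symm x)
      rw [LieEquiv.apply_symm_apply] at this
      rw [this, LieEquiv.apply_symm_apply]
    rw [h3, ← hφ2, ← hcomm, h1]
end Part12

end Helpers

/-- Every dyad `{σ₁, σ₂}` arises from an inner automorphism `φ` of
order dividing `4`: `σ₂ = φ ∘ σ₁ ∘ φ⁻¹` and `σ₁ ∘ σ₂ = φ²`. -/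
theorem dyad_from_order_four (σ₁ σ₂ : g ≃ₗ⁅k⁆ g) (h : IsDyad k g σ₁ σ₂) :
    ∃ φ : g ≃ₗ⁅k⁆ g, IsInnerAut k g φ ∧ (∀ x, φ (φ (φ (φ x))) = x) ∧
      (∀ x, σ₂ x = φ (σ₁ (φ.symm x))) ∧ (∀ x, σ₁ (σ₂ x) = φ (φ x)) :=
  dyad_final σ₁ σ₂ h
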